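/- arXiv:math/0307204 — 3 statements merged into one kernel-verified Lean document; each statement's English description precedes it below -/
import Mathlib

section
/- Fix an integer p ≥ 2, an index j ∈ {1,…,p−1}, ε ∈ (0,1/2), r > 0, and α ∈ (0,1/4). Then there exists a constant c > 0 such that for every integer n ≥ 1 and every t ∈ [ε, 1−ε], the probability, under the uniform distribution on (p,2n)-watermelons with wall condition, of the event { W_{j+1}(⌊2nt⌋)² − W_j(⌊2nt⌋)² ≤ n^α and W_p(⌊2nt⌋) ≤ r·√(2n) } is at most c · n^{3(α − 1/2)}. -/
open MeasureTheory Filter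

/-- A star of length `m` with wall condition, with `p` branches, encoded as a
function `Fin p → ℕ → ℤ` (values beyond time `m` are pinned to `0` so that the
collection of stars is a finite set). Branch `i` (0-indexed) starts at `2i`. -/
def IsStarW (p m : ℕ) (w : Fin p → ℕ → ℤ) : Prop :=
  (∀ i : Fin p, w i 0 = 2 * ((i : ℕ) : ℤ)) ∧
  (∀ i : Fin p, ∀ k, k < m → (w i (k + 1) - w i k = 1 ∨ w i (k + 1) - w i k = -1)) ∧
  (∀ i : Fin p, ∀ k, k ≤ m → 0 ≤ w i k) ∧
  (∀ i j : Fin p, i < j → ∀ k, k ≤ m → w i k < w j k) ∧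
  (∀ i : Fin p, ∀ k, m < k → w i k = 0)

/-- A `(p,2n)`-watermelon with wall condition. -/
def IsMelonW (p n : ℕ) (w : Fin p → ℕ → ℤ) : Prop :=
  IsStarW p (2 * n) w ∧ ∀ i : Fin p, w i (2 * n) = 2 * ((i : ℕ) : ℤ)

/-- Probability of the event `E` under the uniform distribution on
`(p,2n)`-watermelons with wall condition. -/
noncomputable def probW (p n : ℕ) (E : (Fin p → ℕ → ℤ) → Prop) : ℝ :=
  (Nat.card {w : Fin p → ℕ → ℤ // IsMelonW p n w ∧ E w} : ℝ) /
    (Nat.card {w : Fin p → ℕ → ℤ // IsMelonW p n w} : ℝ)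

/-- The number of simple walks of length `M` from `0` to `y`. -/
noncomputable def walkCount : ℕ → ℤ → ℝ
  | 0, y => if y = 0 then 1 else 0
  | M + 1, y => walkCount M (y - 1) + walkCount M (y + 1)

lemma walkCount_succ (M : ℕ) (y : ℤ) :
    walkCount (M + 1) y = walkCount M (y - 1) + walkCount M (y + 1) := rfl

lemma walkCount_nonneg (M : ℕ) (y : ℤ) : 0 ≤ walkCount M y := by
  induction M generalizing y with
  | zero => simp only [walkCount]; split_ifs <;> norm_num
  | succ M ih => rw [walkCount_succ]; exact add_nonneg (ih _) (ih _)

lemma walkCount_eq_zero_of_lt (M : ℕ) (y : ℤ) (h : (M : ℤ) < y) : walkCount M y = 0 := by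
  induction M generalizing y with
  | zero => simp only [walkCount]; rw [if_neg]; push_cast at h; omega
  | succ M ih =>
    push_cast at h
    rw [walkCount_succ, ih _ (by omega), ih _ (by omega), add_zero]

lemma walkCount_pos (M : ℕ) (y : ℤ) (h : ((M : ℤ) + y) % 2 = 0) (h1 : -(M : ℤ) ≤ y)
    (h2 : y ≤ M) : 0 < walkCount M y := by
  induction M generalizing y with
  | zero =>
    have : y = 0 := by push_cast at h1 h2; omega
    simp [walkCount, this]
  | succ M ih =>
    push_cast at h h1 h2
    rw [walkCount_succ]
    rcases le_or_gt 0 y with hy | hy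
    · exact add_pos_of_pos_of_nonneg (ih _ (by omega) (by omega) (by omega))
        (walkCount_nonneg _ _)
    · exact add_pos_of_nonneg_of_pos (walkCount_nonneg _ _)
        (ih _ (by omega) (by omega) (by omega))

lemma walkCount_balance (M : ℕ) (y : ℤ) :
    ((M : ℝ) + 1 - y) * walkCount M (y - 1) = ((M : ℝ) + 1 + y) * walkCount M (y + 1) := by
  induction M generalizing y with
  | zero =>
    simp only [walkCount]
    by_cases h1 : y = 1
    · subst h1; norm_num
    · by_cases h2 : y = -1
      · subst h2; norm_num
      · rw [if_neg (by omega), if_neg (by omega)]; simp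
  | succ M ih =>
    have e1 := ih (y - 1)
    have e2 := ih (y + 1)
    rw [walkCount_succ, walkCount_succ]
    simp only [sub_add_cancel, add_sub_cancel_right] at e1 e2 ⊢
    push_cast at e1 e2 ⊢
    linear_combination e1 + e2

lemma walkCount_pred_left (M : ℕ) (y : ℤ) :
    2 * ((M : ℝ) + 1) * walkCount M (y - 1) = ((M : ℝ) + 1 + y) * walkCount (M + 1) y := by
  rw [walkCount_succ]; linear_combination walkCount_balance M y

lemma walkCount_pred_right (M : ℕ) (y : ℤ) :
    2 * ((M : ℝ) + 1) * walkCount M (y + 1) = ((M : ℝ) + 1 - y) * walkCount (M + 1) y := by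
  rw [walkCount_succ]; linear_combination -walkCount_balance M y

lemma walkCount_sub_eq (M : ℕ) (y : ℤ) :
    walkCount M (y - 1) - walkCount M (y + 1) =
      ((M : ℝ) + 1)⁻¹ * (y * walkCount (M + 1) y) := by
  have : (M : ℝ) + 1 ≠ 0 := by positivity
  field_simp
  linear_combination (walkCount_pred_left M y - walkCount_pred_right M y) / 2

lemma walkCount_two_step (M : ℕ) (y : ℤ) :
    4 * ((M : ℝ) + 2) * ((M : ℝ) + 1) * walkCount M y =
      (((M : ℝ) + 2) ^ 2 - (y : ℝ) ^ 2) * walkCount (M + 2) y := by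
  have e1 := walkCount_pred_right M (y - 1)
  have e2 := walkCount_pred_left (M + 1) y
  rw [sub_add_cancel] at e1
  push_cast at e1 e2
  linear_combination 2 * ((M : ℝ) + 2) * e1 + ((M : ℝ) + 2 - y) * e2

open Polynomial in
lemma exists_monic_walkCount (l N : ℕ) : ∃ c : ℝ, c ≠ 0 ∧ ∃ Q : ℝ[X], Q.Monic ∧
    Q.natDegree = l ∧
      ∀ y : ℤ, walkCount N y = c * Q.eval ((y : ℝ) ^ 2) * walkCount (N + 2 * l) y := by
  induction l generalizing N with
  | zero => exact ⟨1, one_ne_zero, 1, monic_one, natDegree_one, fun y => by simp⟩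
  | succ l ih =>
    obtain ⟨c, hc, Q, hQ, hd, h⟩ := ih (N + 2)
    have hm : (4 * ((N : ℝ) + 2) * ((N : ℝ) + 1)) ≠ 0 := by positivity
    refine ⟨-(4 * ((N : ℝ) + 2) * ((N : ℝ) + 1))⁻¹ * c,
      mul_ne_zero (neg_ne_zero.2 (inv_ne_zero hm)) hc, (X - C (((N : ℝ) + 2) ^ 2)) * Q,
      (monic_X_sub_C _).mul hQ, ?_, fun y => ?_⟩
    · rw [(monic_X_sub_C _).natDegree_mul hQ, natDegree_X_sub_C, hd, add_comm]
    · have e := walkCount_two_step N y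
      rw [h y, show N + 2 + 2 * l = N + 2 * (l + 1) by ring] at e
      simp only [eval_mul, eval_sub, eval_X, eval_C]
      apply mul_left_cancel₀ hm
      rw [e]
      field_simp
      ring

lemma walkCount_step (M : ℕ) (y : ℤ) :
    ((M : ℝ) - y) * walkCount M y = ((M : ℝ) + 2 + y) * walkCount M (y + 2) := by
  have e := walkCount_balance M (y + 1)
  rw [add_sub_cancel_right, show y + 1 + 1 = y + 2 by ring] at e
  push_cast at e
  linear_combination e

lemma walkCount_step_le (M : ℕ) (y : ℤ) (hy : 0 ≤ y) :
    walkCount M (y + 2) ≤ walkCount M y := by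
  have e := walkCount_step M y
  have hy' : (0 : ℝ) ≤ y := by exact_mod_cast hy
  have hM : (0 : ℝ) ≤ M := Nat.cast_nonneg M
  have h0 := walkCount_nonneg M y
  refine le_of_mul_le_mul_left (a := (M : ℝ) + 2 + y) ?_ (by positivity)
  rw [← e]
  nlinarith

lemma walkCount_le_base (M e z : ℕ) : walkCount M (e + 2 * z) ≤ walkCount M e := by
  induction z with
  | zero => simp
  | succ z ih =>
    refine le_trans ?_ ih
    have := walkCount_step_le M (e + 2 * z) (by positivity)
    push_cast
    rwa [show (e : ℤ) + 2 * (z + 1) = e + 2 * z + 2 by ring]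

/-- Within distance of order `√M` of the origin the walk counts are comparable. -/
lemma walkCount_ge_base (M e z : ℕ) (Y : ℝ) (hM : 0 < M) (hY : (e : ℝ) + 2 * z ≤ Y) :
    (1 - z * (2 * Y + 2) / M) * walkCount M e ≤ walkCount M (e + 2 * z) := by
  induction z with
  | zero => simp
  | succ z ih =>
    push_cast at hY
    specialize ih (by linarith)
    have hs := walkCount_step M (e + 2 * z)
    have hb := walkCount_le_base M e z
    have h0 := walkCount_nonneg M (e + 2 * z)
    have hM' : (0 : ℝ) < M := by exact_mod_cast hM
    push_cast at hs ⊢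
    rw [show (e : ℤ) + 2 * (z + 1) = e + 2 * z + 2 by ring]
    set y : ℝ := (e : ℝ) + 2 * z with hy
    have hy0 : 0 ≤ y := by positivity
    have hden : 0 < (M : ℝ) + 2 + y := by positivity
    have h1 : walkCount M (e + 2 * z + 2) =
        walkCount M (e + 2 * z) - (2 * y + 2) / (M + 2 + y) * walkCount M (e + 2 * z) := by
      field_simp
      linear_combination -hs
    have h2 : (2 * y + 2) / (M + 2 + y) * walkCount M (e + 2 * z) ≤
        (2 * Y + 2) / M * walkCount M e := by
      apply mul_le_mul _ hb h0 (by apply div_nonneg <;> linarith)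
      apply div_le_div₀ <;> linarith
    rw [h1]
    have : (1 - ((z : ℝ) + 1) * (2 * Y + 2) / M) * walkCount M e =
      (1 - z * (2 * Y + 2) / M) * walkCount M e - (2 * Y + 2) / M * walkCount M e := by ring
    linarith

/-- The determinant of reflected walk counts; it solves the recurrence of the star counts. -/
noncomputable def walkDet (p m : ℕ) (y : Fin p → ℤ) : ℝ :=
  (Matrix.of fun i l : Fin p =>
    walkCount (m + 2 * (p - 1 - l)) (y i - 1) - walkCount (m + 2 * (p - 1 - l)) (y i + 1)).det

/-- The product formula for the number of stars with end points `y i - 1`,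
up to a constant depending on `p` and `m` only. -/
noncomputable def starWeight (p m : ℕ) (y : Fin p → ℤ) : ℝ :=
  (∏ i, (y i * walkCount (m + 2 * (p - 1) + 1) (y i))) *
    ∏ i, ∏ j ∈ Finset.Ioi i, ((y j : ℝ) ^ 2 - (y i : ℝ) ^ 2)

lemma exists_walkDet_eq_mul_starWeight (p m : ℕ) :
    ∃ K : ℝ, K ≠ 0 ∧ ∀ y, walkDet p m y = K * starWeight p m y := by
  choose c hc Q hQ hd h using fun l : Fin p =>
    exists_monic_walkCount l (m + 2 * (p - 1 - l) + 1)
  refine ⟨∏ l : Fin p, ((((m + 2 * (p - 1 - l) : ℕ) : ℝ) + 1)⁻¹ * c l),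
    Finset.prod_ne_zero_iff.2 fun l _ => mul_ne_zero (by positivity) (hc l), fun y => ?_⟩
  have hM (l : Fin p) : m + 2 * (p - 1 - l) + 1 + 2 * l = m + 2 * (p - 1) + 1 := by
    have := l.2; omega
  rw [starWeight, ← Matrix.det_vandermonde,
    Matrix.det_eval_matrixOfPolynomials_eq_det_vandermonde _ Q hd hQ,
    ← Matrix.det_mul_column, ← Matrix.det_mul_row, walkDet]
  congr 1
  ext i l
  simp only [Matrix.of_apply]
  rw [walkCount_sub_eq, h l, hM]
  ring

/-- The sign vectors. -/
def signs (p : ℕ) : Finset (Fin p → ℤ) := Fintype.piFinset fun _ => {1, -1}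

lemma mem_signs {p : ℕ} {s : Fin p → ℤ} : s ∈ signs p ↔ ∀ i, s i = 1 ∨ s i = -1 := by
  simp [signs]

lemma walkDet_succ (p m : ℕ) (y : Fin p → ℤ) :
    walkDet p (m + 1) y = ∑ s ∈ signs p, walkDet p m (y - s) := by
  simp only [walkDet]
  rw [← Matrix.det_transpose]
  conv_rhs => enter [2, s]; rw [← Matrix.det_transpose]
  simp only [Matrix.det_apply', Matrix.transpose_apply, Matrix.of_apply]
  rw [Finset.sum_comm]
  refine Finset.sum_congr rfl fun σ _ => ?_
  rw [← Finset.mul_sum, signs]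
  congr 1
  simp only [Pi.sub_apply]
  rw [← Finset.prod_univ_sum (fun _ => ({1, -1} : Finset ℤ)) (fun i s =>
    walkCount (m + 2 * (p - 1 - (σ i : ℕ))) (y i - s - 1) -
      walkCount (m + 2 * (p - 1 - (σ i : ℕ))) (y i - s + 1))]
  refine Finset.prod_congr rfl fun i _ => ?_
  rw [Finset.sum_pair (by norm_num), show m + 1 + 2 * (p - 1 - (σ i : ℕ)) =
    m + 2 * (p - 1 - (σ i : ℕ)) + 1 by ring, walkCount_succ, walkCount_succ]
  simp only [sub_add_cancel, add_sub_cancel_right, sub_neg_eq_add]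
  ring

lemma walkDet_eq_zero_of_eq_zero {p m : ℕ} {y : Fin p → ℤ} (i : Fin p) (h : y i = 0) :
    walkDet p m y = 0 := by
  obtain ⟨K, -, hK⟩ := exists_walkDet_eq_mul_starWeight p m
  rw [hK, starWeight, Finset.prod_eq_zero (Finset.mem_univ i) (by simp [h])]
  simp

lemma walkDet_eq_zero_of_eq {p m : ℕ} {y : Fin p → ℤ} {i j : Fin p} (hij : i ≠ j)
    (h : y i = y j) : walkDet p m y = 0 :=
  Matrix.det_zero_of_row_eq hij (by ext l; simp [h])

/-- The possible positions of the branches of a star. -/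
def Chamber {p : ℕ} (x : Fin p → ℤ) : Prop := (∀ i, 0 ≤ x i) ∧ StrictMono x

/-- The common starting positions of the stars. -/
def startPos (p : ℕ) : Fin p → ℤ := fun i => 2 * ((i : ℕ) : ℤ)

lemma chamber_startPos (p : ℕ) : Chamber (startPos p) :=
  ⟨fun i => by simp [startPos], fun i j h => by
    have : (i : ℕ) < j := h
    simp only [startPos]; omega⟩

lemma starWeight_pos {p m : ℕ} {x : Fin p → ℤ} (hx : Chamber x)
    (h : ∀ i, (x i - m) % 2 = 0) (h1 : ∀ i, x i ≤ m + 2 * ((p - 1 : ℕ) : ℤ)) :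
    0 < starWeight p m (x + 1) := by
  refine mul_pos (Finset.prod_pos fun i _ => mul_pos ?_ (walkCount_pos _ _ ?_ ?_ ?_))
    (Finset.prod_pos fun i _ => Finset.prod_pos fun j hj => ?_)
  · have := hx.1 i
    simp only [Pi.add_apply, Pi.one_apply]; exact_mod_cast (by omega : 0 < x i + 1)
  · have := h i
    simp only [Pi.add_apply, Pi.one_apply]; push_cast; omega
  · have := hx.1 i
    simp only [Pi.add_apply, Pi.one_apply]; push_cast; omega
  · have := h1 i
    simp only [Pi.add_apply, Pi.one_apply]; push_cast; omega
  · have h2 := hx.2 (Finset.mem_Ioi.1 hj)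
    have h3 := hx.1 i
    have h2' : (x i : ℝ) < x j := by exact_mod_cast h2
    have h3' : (0 : ℝ) ≤ x i := by exact_mod_cast h3
    simp only [Pi.add_apply, Pi.one_apply]; push_cast; nlinarith

lemma walkDet_startPos_ne_zero (p : ℕ) : walkDet p 0 (startPos p + 1) ≠ 0 := by
  obtain ⟨K, hK0, hK⟩ := exists_walkDet_eq_mul_starWeight p 0
  rw [hK]
  refine mul_ne_zero hK0 (starWeight_pos (chamber_startPos p) (fun i => ?_) fun i => ?_).ne'
  · simp [startPos]
  · have := i.2
    simp only [startPos]; push_cast; omega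

lemma two_mul_le_of_chamber {p : ℕ} {x : Fin p → ℤ} (hx : Chamber x)
    (h : ∀ i, x i % 2 = 0) (i : Fin p) : 2 * ((i : ℕ) : ℤ) ≤ x i := by
  obtain ⟨k, hk⟩ := i
  induction k with
  | zero => simpa using hx.1 ⟨0, hk⟩
  | succ k ih =>
    have h1 := ih (by omega)
    have h2 : x ⟨k, by omega⟩ < x ⟨k + 1, hk⟩ := hx.2 (by simp)
    have h3 := h ⟨k, by omega⟩
    have h4 := h ⟨k + 1, hk⟩
    simp only at h1 ⊢; push_cast; omega

lemma le_two_mul_of_chamber {p : ℕ} {x : Fin p → ℤ} (hx : Chamber x)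
    (h : ∀ i, x i % 2 = 0) (h1 : ∀ i, x i ≤ 2 * ((p - 1 : ℕ) : ℤ)) (i : Fin p) :
    x i ≤ 2 * ((i : ℕ) : ℤ) := by
  obtain ⟨k, hk⟩ := i
  obtain ⟨d, hd⟩ : ∃ d, k + d = p - 1 := ⟨p - 1 - k, by omega⟩
  induction d generalizing k with
  | zero => have := h1 ⟨k, hk⟩; simp only; omega
  | succ d ih =>
    have h1 := ih (k + 1) (by omega) (by omega)
    have h2 : x ⟨k, hk⟩ < x ⟨k + 1, by omega⟩ := hx.2 (by simp)
    have h3 := h ⟨k, hk⟩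
    have h4 := h ⟨k + 1, by omega⟩
    simp only at h1 ⊢; push_cast at h1; omega

lemma walkDet_zero_eq_zero {p : ℕ} {x : Fin p → ℤ} (hx : Chamber x)
    (h : ∀ i, x i % 2 = 0) (hne : x ≠ startPos p) : walkDet p 0 (x + 1) = 0 := by
  obtain ⟨K, -, hK⟩ := exists_walkDet_eq_mul_starWeight p 0
  have : ∃ i, 2 * ((p - 1 : ℕ) : ℤ) < x i := by
    by_contra! h1
    exact hne (funext fun i => le_antisymm (le_two_mul_of_chamber hx h h1 i)
      (two_mul_le_of_chamber hx h i))
  obtain ⟨i, hi⟩ := this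
  rw [hK, starWeight, Finset.prod_eq_zero (Finset.mem_univ i)]
  · simp
  · rw [walkCount_eq_zero_of_lt, mul_zero]
    simp only [Pi.add_apply, Pi.one_apply]; push_cast; omega

lemma finite_isStarW (p m : ℕ) : Finite {w : Fin p → ℕ → ℤ // IsStarW p m w} := by
  have hb (w : Fin p → ℕ → ℤ) (hw : IsStarW p m w) (i : Fin p) (k : ℕ) (hk : k ≤ m) :
      w i k ≤ 2 * p + k := by
    induction k with
    | zero => rw [hw.1]; have := i.2; push_cast; omega
    | succ k ih =>
      have := ih (by omega)
      have := hw.2.1 i k (by omega)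
      push_cast; omega
  let f : {w : Fin p → ℕ → ℤ // IsStarW p m w} →
      Fin p → Fin (m + 1) → Finset.Icc (0 : ℤ) (2 * p + m) := fun w i k =>
    ⟨w.1 i k, Finset.mem_Icc.2 ⟨w.2.2.2.1 i k (by omega), by
      have := hb w.1 w.2 i k (by omega)
      have := k.2
      omega⟩⟩
  refine Finite.of_injective f fun w v h => Subtype.ext ?_
  funext i k
  rcases le_or_gt k m with hk | hk
  · have := congrFun (congrFun h i) ⟨k, by omega⟩
    simpa [f] using this
  · rw [w.2.2.2.2.2 i k hk, v.2.2.2.2.2 i k hk]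

lemma card_subtype_eq_sum_fiber {α β : Type*} (P : α → Prop) [hP : Finite {a // P a}]
    (f : α → β) (S : Finset β) :
    Nat.card {a // P a ∧ f a ∈ S} = ∑ b ∈ S, Nat.card {a // P a ∧ f a = b} := by
  classical
  have := Fintype.ofFinite {a // P a}
  have key (R : β → Prop) : Nat.card {a // P a ∧ R (f a)} =
      (Finset.univ.filter fun a : {a // P a} => R (f a)).card := by
    rw [← Nat.card_congr (Equiv.subtypeSubtypeEquivSubtypeInter P fun a => R (f a)),
      Nat.card_eq_fintype_card, Fintype.card_subtype]
  rw [key (· ∈ S), Finset.card_eq_sum_card_fiberwise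
    (f := fun a : {a // P a} => f a) (t := S) fun a ha => by simpa using ha]
  refine Finset.sum_congr rfl fun b hb => ?_
  rw [key (· = b), Finset.filter_filter]
  congr 1
  ext a
  simp only [Finset.mem_filter, Finset.mem_univ, true_and]
  exact ⟨fun h => h.2, fun h => ⟨h ▸ hb, h⟩⟩

/-- The number of stars of length `m` with end points `x`. -/
noncomputable def starCount (p m : ℕ) (x : Fin p → ℤ) : ℕ :=
  Nat.card {w : Fin p → ℕ → ℤ // IsStarW p m w ∧ (fun i => w i m) = x}

lemma chamber_of_isStarW {p m : ℕ} {w : Fin p → ℕ → ℤ} (hw : IsStarW p m w) {k : ℕ}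
    (hk : k ≤ m) : Chamber fun i => w i k :=
  ⟨fun i => hw.2.2.1 i k hk, fun i j h => hw.2.2.2.1 i j h k hk⟩

lemma parity_of_isStarW {p m : ℕ} {w : Fin p → ℕ → ℤ} (hw : IsStarW p m w) {k : ℕ}
    (hk : k ≤ m) (i : Fin p) : (w i k - k) % 2 = 0 := by
  induction k with
  | zero => rw [hw.1]; push_cast; omega
  | succ k ih =>
    have := ih (by omega)
    have := hw.2.1 i k (by omega)
    push_cast; omega

lemma starCount_eq_zero {p m : ℕ} {x : Fin p → ℤ}
    (h : ¬ (Chamber x ∧ ∀ i, (x i - m) % 2 = 0)) : starCount p m x = 0 := by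
  have : IsEmpty {w : Fin p → ℕ → ℤ // IsStarW p m w ∧ (fun i => w i m) = x} := by
    refine ⟨fun w => h ?_⟩
    obtain ⟨w, hw, rfl⟩ := w
    exact ⟨chamber_of_isStarW hw le_rfl, parity_of_isStarW hw le_rfl⟩
  rw [starCount, Nat.card_of_isEmpty]

lemma starCount_zero (p : ℕ) : starCount p 0 (startPos p) = 1 := by
  rw [starCount, Nat.card_eq_one_iff_unique]
  refine ⟨⟨fun w v => Subtype.ext ?_⟩, ⟨⟨fun i k => if k = 0 then startPos p i else 0,
    ⟨fun i => by simp [startPos], fun i k hk => by omega, fun i k hk => ?_,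
      fun i j hij k hk => ?_, fun i k hk => if_neg (by omega)⟩, by simp⟩⟩⟩
  · funext i k
    rcases Nat.eq_zero_or_pos k with rfl | hk
    · rw [w.2.1.1, v.2.1.1]
    · rw [w.2.1.2.2.2.2 i k hk, v.2.1.2.2.2.2 i k hk]
  · simp only [if_pos (show k = 0 by omega)]; exact (chamber_startPos p).1 i
  · simp only [if_pos (show k = 0 by omega)]; exact (chamber_startPos p).2 hij

lemma starCount_zero_of_ne {p : ℕ} {x : Fin p → ℤ} (h : x ≠ startPos p) :
    starCount p 0 x = 0 := by
  have : IsEmpty {w : Fin p → ℕ → ℤ // IsStarW p 0 w ∧ (fun i => w i 0) = x} := by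
    refine ⟨fun w => h ?_⟩
    obtain ⟨w, hw, rfl⟩ := w
    exact funext hw.1
  rw [starCount, Nat.card_of_isEmpty]

/-- Removing the last step of a star. -/
noncomputable def starFiberEquiv (p m : ℕ) (x s : Fin p → ℤ) (hx : Chamber x)
    (hs : s ∈ signs p) :
    {w : Fin p → ℕ → ℤ // (IsStarW p (m + 1) w ∧ (fun i => w i (m + 1)) = x) ∧
      (fun i => w i (m + 1) - w i m) = s} ≃
    {w : Fin p → ℕ → ℤ // IsStarW p m w ∧ (fun i => w i m) = x - s} where
  toFun w := ⟨fun i k => if k ≤ m then w.1 i k else 0, by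
    obtain ⟨w, ⟨⟨h1, h2, h3, h4, h5⟩, rfl⟩, rfl⟩ := w
    refine ⟨⟨fun i => by simp [h1], fun i k hk => ?_, fun i k hk => ?_, fun i j hij k hk => ?_,
      fun i k hk => if_neg (by omega)⟩, ?_⟩
    · simp only [if_pos (show k + 1 ≤ m by omega), if_pos hk.le]; exact h2 i k (by omega)
    · simp only [if_pos hk]; exact h3 i k (by omega)
    · simp only [if_pos hk]; exact h4 i j hij k (by omega)
    · ext i; simp⟩
  invFun w := ⟨fun i k => if k = m + 1 then x i else w.1 i k, by
    obtain ⟨w, ⟨h1, h2, h3, h4, h5⟩, h⟩ := w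
    have hm (i) : w i m = x i - s i := congrFun h i
    rw [mem_signs] at hs
    refine ⟨⟨⟨fun i => by simp [h1], fun i k hk => ?_, fun i k hk => ?_, fun i j hij k hk => ?_,
      fun i k hk => ?_⟩, ?_⟩, ?_⟩
    · rcases eq_or_ne k m with rfl | hk'
      · have := hs i
        simp [hm]; omega
      · simp only [if_neg (show k + 1 ≠ m + 1 by omega), if_neg (show k ≠ m + 1 by omega)]
        exact h2 i k (by omega)
    · simp only; split_ifs
      · exact hx.1 i
      · exact h3 i k (by omega)
    · simp only; split_ifs
      · exact hx.2 hij
      · exact h4 i j hij k (by omega)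
    · simp only [if_neg (show k ≠ m + 1 by omega)]; exact h5 i k (by omega)
    · ext i; simp
    · ext i; simp [hm]⟩
  left_inv w := by
    obtain ⟨w, ⟨⟨h1, h2, h3, h4, h5⟩, rfl⟩, rfl⟩ := w
    ext i k
    simp only
    split_ifs with h h'
    · rw [h]
    · rfl
    · rw [h5 i k (by omega)]
  right_inv w := by
    obtain ⟨w, ⟨h1, h2, h3, h4, h5⟩, h⟩ := w
    ext i k
    simp only
    split_ifs with h h'
    · omega
    · rfl
    · rw [h5 i k (by omega)]

lemma starCount_succ (p m : ℕ) (x : Fin p → ℤ) (hx : Chamber x) :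
    starCount p (m + 1) x = ∑ s ∈ signs p, starCount p m (x - s) := by
  have := finite_isStarW p (m + 1)
  have hf : Finite {w : Fin p → ℕ → ℤ // IsStarW p (m + 1) w ∧ (fun i => w i (m + 1)) = x} :=
    Finite.of_injective (fun w => (⟨w.1, w.2.1⟩ : {w // IsStarW p (m + 1) w}))
      fun w v h => Subtype.ext (by simpa using h)
  rw [starCount]
  simp only [starCount]
  rw [← Finset.sum_congr rfl fun s hs => Nat.card_congr (starFiberEquiv p m x s hx hs),
    ← card_subtype_eq_sum_fiber _ (fun w : Fin p → ℕ → ℤ => fun i => w i (m + 1) - w i m)]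
  refine Nat.card_congr (Equiv.subtypeEquivRight fun w => ?_)
  simp only [iff_self_and]
  exact fun h => mem_signs.2 fun i => h.1.2.1 i m (by omega)

lemma starCount_mul_walkDet {p m : ℕ} {x : Fin p → ℤ} (hx : Chamber x)
    (h : ∀ i, (x i - m) % 2 = 0) :
    starCount p m x * walkDet p 0 (startPos p + 1) = walkDet p m (x + 1) := by
  induction m generalizing x with
  | zero =>
    by_cases hxs : x = startPos p
    · subst hxs; simp [starCount_zero]
    · rw [starCount_zero_of_ne hxs, walkDet_zero_eq_zero hx (by simpa using h) hxs]; simp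
  | succ m ih =>
    rw [starCount_succ p m x hx, walkDet_succ]
    push_cast
    rw [Finset.sum_mul]
    refine Finset.sum_congr rfl fun s hs => ?_
    rw [mem_signs] at hs
    rw [show x + 1 - s = (x - s) + 1 by ring]
    have hpar (i) : ((x - s) i - m) % 2 = 0 := by
      have := h i
      have := hs i
      push_cast at *; simp only [Pi.sub_apply]; omega
    by_cases hc : Chamber (x - s)
    · exact ih hc hpar
    · rw [starCount_eq_zero fun h => hc h.1, Nat.cast_zero, zero_mul, eq_comm]
      by_cases h0 : ∃ i, (x - s + 1) i = 0
      · exact walkDet_eq_zero_of_eq_zero _ h0.choose_spec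
      have hcn : ¬ StrictMono (x - s) := fun hm => hc ⟨fun i => by
        push Not at h0
        have h1 := h0 i
        have h2 := hx.1 i
        have h3 := hs i
        simp only [Pi.add_apply, Pi.sub_apply, Pi.one_apply] at *; omega, hm⟩
      simp only [StrictMono, not_forall] at hcn
      obtain ⟨i, j, hij, hn⟩ := hcn
      refine walkDet_eq_zero_of_eq hij.ne ?_
      have h1 := hx.2 hij
      have h2 := hs i
      have h3 := hs j
      have h4 := h i
      have h5 := h j
      simp only [Pi.add_apply, Pi.sub_apply, Pi.one_apply] at *; push_cast at *; omega

/-- The number of stars with prescribed end points factorizes, up to a constant. -/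
lemma exists_starCount_eq (p m : ℕ) : ∃ κ : ℝ, 0 < κ ∧ ∀ x : Fin p → ℤ, Chamber x →
    (∀ i, (x i - m) % 2 = 0) → starCount p m x = κ * |starWeight p m (x + 1)| := by
  obtain ⟨K, hK0, hK⟩ := exists_walkDet_eq_mul_starWeight p m
  have hD := walkDet_startPos_ne_zero p
  refine ⟨|K / walkDet p 0 (startPos p + 1)|, abs_pos.2 (div_ne_zero hK0 hD), fun x hx h => ?_⟩
  have e := starCount_mul_walkDet hx h
  rw [hK] at e
  rw [← abs_mul, div_mul_eq_mul_div, ← e, mul_div_cancel_right₀ _ hD, Nat.abs_cast]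

/-- Cutting a watermelon at time `m`. -/
noncomputable def melonFiberEquiv (p n m m' : ℕ) (hm : m + m' = 2 * n) (x : Fin p → ℤ) :
    {w : Fin p → ℕ → ℤ // IsMelonW p n w ∧ (fun i => w i m) = x} ≃
    {w : Fin p → ℕ → ℤ // IsStarW p m w ∧ (fun i => w i m) = x} ×
      {w : Fin p → ℕ → ℤ // IsStarW p m' w ∧ (fun i => w i m') = x} where
  toFun w := (⟨fun i k => if k ≤ m then w.1 i k else 0, by
    obtain ⟨w, ⟨⟨h1, h2, h3, h4, h5⟩, h6⟩, rfl⟩ := w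
    refine ⟨⟨fun i => by simp [h1], fun i k hk => ?_, fun i k hk => ?_, fun i j hij k hk => ?_,
      fun i k hk => if_neg (by omega)⟩, ?_⟩
    · simp only [if_pos (show k + 1 ≤ m by omega), if_pos hk.le]; exact h2 i k (by omega)
    · simp only [if_pos hk]; exact h3 i k (by omega)
    · simp only [if_pos hk]; exact h4 i j hij k (by omega)
    · ext i; simp⟩, ⟨fun i k => if k ≤ m' then w.1 i (2 * n - k) else 0, by
    obtain ⟨w, ⟨⟨h1, h2, h3, h4, h5⟩, h6⟩, rfl⟩ := w
    refine ⟨⟨fun i => by simp [h6], fun i k hk => ?_, fun i k hk => ?_, fun i j hij k hk => ?_,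
      fun i k hk => if_neg (by omega)⟩, ?_⟩
    · simp only [if_pos (show k + 1 ≤ m' by omega), if_pos hk.le]
      have := h2 i (2 * n - (k + 1)) (by omega)
      rw [show 2 * n - (k + 1) + 1 = 2 * n - k by omega] at this
      omega
    · simp only [if_pos hk]; exact h3 i _ (by omega)
    · simp only [if_pos hk]; exact h4 i j hij _ (by omega)
    · ext i; simp [show 2 * n - m' = m by omega]⟩)
  invFun u := ⟨fun i k => if k ≤ m then u.1.1 i k else if k ≤ 2 * n then u.2.1 i (2 * n - k)
      else 0, by
    obtain ⟨⟨w, ⟨h1, h2, h3, h4, h5⟩, rfl⟩, ⟨v, ⟨g1, g2, g3, g4, g5⟩, h⟩⟩ := u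
    have hv (i) : v i m' = w i m := congrFun h i
    refine ⟨⟨⟨fun i => by simp [h1], fun i k hk => ?_, fun i k hk => ?_, fun i j hij k hk => ?_,
      fun i k hk => ?_⟩, fun i => ?_⟩, ?_⟩
    · simp only
      rcases lt_or_ge k m with hkm | hkm
      · rw [if_pos (show k + 1 ≤ m by omega), if_pos hkm.le]; exact h2 i k hkm
      · have e : (if k ≤ m then w i k else if k ≤ 2 * n then v i (2 * n - k) else 0) =
            v i (2 * n - k) := by
          split_ifs with h'
          · have : k = m := by omega
            rw [this, show 2 * n - m = m' by omega, hv]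
          · rfl
          · omega
        rw [e, if_neg (by omega), if_pos (by omega)]
        have := g2 i (2 * n - (k + 1)) (by omega)
        rw [show 2 * n - (k + 1) + 1 = 2 * n - k by omega] at this
        omega
    · simp only; split_ifs
      · exact h3 i k (by omega)
      · exact g3 i _ (by omega)
    · simp only; split_ifs
      · exact h4 i j hij k (by omega)
      · exact g4 i j hij _ (by omega)
    · simp only [if_neg (show ¬ k ≤ m by omega), if_neg (show ¬ k ≤ 2 * n by omega)]
    · simp only
      split_ifs with h'
      · obtain rfl : m' = 0 := by omega
        rw [show 2 * n = m by omega, ← hv, g1]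
      · simp [g1]
      · omega
    · ext i; simp⟩
  left_inv w := by
    obtain ⟨w, ⟨⟨h1, h2, h3, h4, h5⟩, h6⟩, rfl⟩ := w
    ext i k
    simp only
    split_ifs with h h' h''
    · rfl
    · rw [show 2 * n - (2 * n - k) = k by omega]
    · omega
    · rw [h5 i k (by omega)]
  right_inv u := by
    obtain ⟨⟨w, ⟨h1, h2, h3, h4, h5⟩, rfl⟩, ⟨v, ⟨g1, g2, g3, g4, g5⟩, h⟩⟩ := u
    have hv (i) : v i m' = w i m := congrFun h i
    refine Prod.ext (Subtype.ext ?_) (Subtype.ext ?_)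
    · funext i k
      simp only
      split_ifs with h
      · rfl
      · rw [h5 i k (by omega)]
    · funext i k
      simp only
      split_ifs with h h' h''
      · rw [show k = m' by omega, show 2 * n - m' = m by omega, hv]
      · rw [show 2 * n - (2 * n - k) = k by omega]
      · omega
      · rw [g5 i k (by omega)]

lemma finite_isMelonW (p n : ℕ) : Finite {w : Fin p → ℕ → ℤ // IsMelonW p n w} :=
  have := finite_isStarW p (2 * n)
  Finite.of_injective (fun w => (⟨w.1, w.2.1⟩ : {w // IsStarW p (2 * n) w}))
    fun w v h => Subtype.ext (by simpa using h)

lemma card_melon_position_mem (p n m m' : ℕ) (hm : m + m' = 2 * n) (S : Finset (Fin p → ℤ)) :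
    Nat.card {w : Fin p → ℕ → ℤ // IsMelonW p n w ∧ (fun i => w i m) ∈ S} =
      ∑ x ∈ S, starCount p m x * starCount p m' x := by
  have := finite_isMelonW p n
  rw [card_subtype_eq_sum_fiber _ (fun w : Fin p → ℕ → ℤ => fun i => w i m)]
  refine Finset.sum_congr rfl fun x _ => ?_
  rw [Nat.card_congr (melonFiberEquiv p n m m' hm x), Nat.card_prod, starCount, starCount]

lemma abs_starWeight_mul_abs (p m m' : ℕ) (y : Fin p → ℤ) :
    |starWeight p m y| * |starWeight p m' y| =
      (∏ i, ((y i : ℝ) ^ 2 * (walkCount (m + 2 * (p - 1) + 1) (y i) *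
        walkCount (m' + 2 * (p - 1) + 1) (y i)))) *
      (∏ i, ∏ j ∈ Finset.Ioi i, ((y j : ℝ) ^ 2 - (y i : ℝ) ^ 2)) ^ 2 := by
  have h : starWeight p m y * starWeight p m' y =
      (∏ i, ((y i : ℝ) ^ 2 * (walkCount (m + 2 * (p - 1) + 1) (y i) *
        walkCount (m' + 2 * (p - 1) + 1) (y i)))) *
      (∏ i, ∏ j ∈ Finset.Ioi i, ((y j : ℝ) ^ 2 - (y i : ℝ) ^ 2)) ^ 2 := by
    simp only [starWeight, Finset.prod_mul_distrib, Finset.prod_pow]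
    ring
  rw [← abs_mul, h, abs_of_nonneg]
  exact mul_nonneg (Finset.prod_nonneg fun i _ => mul_nonneg (sq_nonneg _)
    (mul_nonneg (walkCount_nonneg _ _) (walkCount_nonneg _ _))) (sq_nonneg _)

/-- The number of pairs of branches. -/
def pairCount (p : ℕ) : ℕ := ∑ i : Fin p, (Finset.Ioi i).card

lemma prod_pairs_const (p : ℕ) (c : ℝ) :
    ∏ i : Fin p, ∏ _j ∈ Finset.Ioi i, c = c ^ pairCount p := by
  simp only [Finset.prod_const, pairCount, Finset.prod_pow_eq_pow_sum]

lemma starWeight_mul_le {p m m' e : ℕ} (he : e ≤ 1) (hem : (m + 1 + e) % 2 = 0)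
    {x : Fin p → ℤ} (hx : Chamber x) (hxm : ∀ i, (x i - m) % 2 = 0)
    {L : Fin p → ℝ} {Y : ℝ} (hL : ∀ i, (x i : ℝ) + 1 ≤ L i) (hLY : ∀ i, L i ≤ Y) :
    |starWeight p m (x + 1)| * |starWeight p m' (x + 1)| ≤
      (walkCount (m + 2 * (p - 1) + 1) e * walkCount (m' + 2 * (p - 1) + 1) e) ^ p *
        (∏ i, L i) ^ 2 * ((Y ^ 2) ^ pairCount p) ^ 2 := by
  have hx0 (i) : (0 : ℝ) ≤ x i := by exact_mod_cast hx.1 i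
  rw [abs_starWeight_mul_abs]
  refine mul_le_mul ?_ ?_ (sq_nonneg _) (mul_nonneg (pow_nonneg (mul_nonneg
    (walkCount_nonneg _ _) (walkCount_nonneg _ _)) _) (sq_nonneg _))
  · have : (walkCount (m + 2 * (p - 1) + 1) e * walkCount (m' + 2 * (p - 1) + 1) e) ^ p *
        (∏ i, L i) ^ 2 = ∏ i, ((L i) ^ 2 * (walkCount (m + 2 * (p - 1) + 1) e *
          walkCount (m' + 2 * (p - 1) + 1) e)) := by
      simp [Finset.prod_mul_distrib, Finset.prod_pow, mul_comm]
    rw [this]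
    refine Finset.prod_le_prod (fun i _ => mul_nonneg (sq_nonneg _)
      (mul_nonneg (walkCount_nonneg _ _) (walkCount_nonneg _ _))) fun i _ => ?_
    obtain ⟨z, hz⟩ : ∃ z : ℕ, x i + 1 = e + 2 * z := by
      have := hx.1 i
      have := hxm i
      exact ⟨((x i + 1 - e) / 2).toNat, by omega⟩
    simp only [Pi.add_apply, Pi.one_apply]
    refine mul_le_mul ?_ ?_ (mul_nonneg (walkCount_nonneg _ _) (walkCount_nonneg _ _))
      (sq_nonneg _)
    · push_cast
      have := hx0 i
      exact pow_le_pow_left₀ (by linarith) (hL i) 2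
    · rw [hz]
      exact mul_le_mul (walkCount_le_base _ _ _) (walkCount_le_base _ _ _)
        (walkCount_nonneg _ _) (walkCount_nonneg _ _)
  · rw [← prod_pairs_const]
    have hd (i j : Fin p) (hij : j ∈ Finset.Ioi i) :
        0 ≤ (((x + 1) j : ℤ) : ℝ) ^ 2 - (((x + 1) i : ℤ) : ℝ) ^ 2 := by
      have h1 : (x i : ℝ) < x j := by exact_mod_cast hx.2 (Finset.mem_Ioi.1 hij)
      have := hx0 i
      simp only [Pi.add_apply, Pi.one_apply]; push_cast; nlinarith
    refine pow_le_pow_left₀ (Finset.prod_nonneg fun i _ => Finset.prod_nonneg (hd i)) ?_ 2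
    refine Finset.prod_le_prod (fun i _ => Finset.prod_nonneg (hd i)) fun i _ =>
      Finset.prod_le_prod (hd i) fun j _ => ?_
    have h1 := hx0 j
    have h2 := (hL j).trans (hLY j)
    simp only [Pi.add_apply, Pi.one_apply]; push_cast
    have := pow_le_pow_left₀ (by linarith) h2 2
    nlinarith [sq_nonneg ((x i : ℝ) + 1)]

lemma walkCount_ge_half {M e z p q : ℕ} (he : e ≤ 1) (hq : 1 ≤ q) (hp : 1 ≤ p)
    (hz : z ≤ 2 * p * q) (hM : 48 * (p * q) ^ 2 ≤ M) :
    walkCount M e / 2 ≤ walkCount M (e + 2 * z) := by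
  have hpq : 1 ≤ p * q := Nat.mul_pos hp hq
  have hM0 : 0 < M := by have := Nat.pow_pos (n := 2) hpq; omega
  have he' : (e : ℝ) ≤ 1 := by exact_mod_cast he
  have hpq' : (1 : ℝ) ≤ (p : ℝ) * q := by exact_mod_cast hpq
  have hz' : (z : ℝ) ≤ 2 * (p * q) := by rw [← mul_assoc]; exact_mod_cast hz
  have hM' : 48 * ((p : ℝ) * q) ^ 2 ≤ M := by exact_mod_cast hM
  refine le_trans ?_ (walkCount_ge_base M e z (5 * (p * q)) hM0 (by linarith))
  rw [div_eq_mul_inv, mul_comm]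
  refine mul_le_mul_of_nonneg_right ?_ (walkCount_nonneg _ _)
  have hM1 : (0 : ℝ) < M := by exact_mod_cast hM0
  have : (z : ℝ) * (2 * (5 * (p * q)) + 2) / M ≤ 1 / 2 := by
    rw [div_le_div_iff₀ hM1 two_pos]
    have : (z : ℝ) * (2 * (5 * (p * q)) + 2) ≤ 2 * (p * q) * (12 * (p * q)) :=
      mul_le_mul hz' (by linarith) (by positivity) (by positivity)
    nlinarith
  norm_num at this ⊢
  linarith

/-- Well-separated positions of order `q`, indexed by `u`. -/
def spreadPos {p : ℕ} (e q : ℕ) (u : Fin p → ℕ) : Fin p → ℤ :=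
  fun i => e + 2 * (((2 * (i : ℕ) + 1) * q + u i : ℕ) : ℤ) - 1

lemma spreadPos_gap {p q : ℕ} {u : Fin p → ℕ} (hu : ∀ i, u i < q) {i j : Fin p} (hij : i < j) :
    (2 * (i : ℕ) + 1) * q + u i + q ≤ (2 * (j : ℕ) + 1) * q + u j := by
  have h1 : ((i : ℕ) + 1) * q ≤ j * q := Nat.mul_le_mul_right q hij
  have h2 := hu i
  nlinarith

lemma chamber_spreadPos {p e q : ℕ} (hq : 1 ≤ q) {u : Fin p → ℕ} (hu : ∀ i, u i < q) :
    Chamber (spreadPos e q u) := by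
  refine ⟨fun i => ?_, fun i j hij => ?_⟩
  · have : 1 ≤ (2 * (i : ℕ) + 1) * q + u i := by nlinarith [Nat.zero_le ((i : ℕ) * q)]
    simp only [spreadPos]; omega
  · have := spreadPos_gap hu hij
    simp only [spreadPos]; omega

lemma spreadPos_injective {p : ℕ} (e q : ℕ) :
    Function.Injective (spreadPos e q : (Fin p → ℕ) → Fin p → ℤ) := fun u v h => by
  funext i
  have := congrFun h i
  simp only [spreadPos] at this
  omega

lemma le_starWeight_mul {p m m' e q : ℕ} (hp : 1 ≤ p) (he : e ≤ 1) (hq : 1 ≤ q)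
    {u : Fin p → ℕ} (hu : ∀ i, u i < q)
    (hM : 48 * (p * q) ^ 2 ≤ m + 2 * (p - 1) + 1)
    (hM' : 48 * (p * q) ^ 2 ≤ m' + 2 * (p - 1) + 1) :
    (walkCount (m + 2 * (p - 1) + 1) e * walkCount (m' + 2 * (p - 1) + 1) e) ^ p *
        (((2 * q : ℝ) ^ 2 / 4) ^ p * (((2 * q : ℝ) ^ 2) ^ pairCount p) ^ 2) ≤
      |starWeight p m (spreadPos e q u + 1)| * |starWeight p m' (spreadPos e q u + 1)| := by
  rw [abs_starWeight_mul_abs, ← mul_assoc]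
  have hz (i : Fin p) : q ≤ (2 * (i : ℕ) + 1) * q + u i := by
    nlinarith [Nat.zero_le ((i : ℕ) * q)]
  have hz2 (i : Fin p) : (2 * (i : ℕ) + 1) * q + u i ≤ 2 * p * q := by
    have h1 : ((i : ℕ) + 1) * q ≤ p * q := Nat.mul_le_mul_right q i.2
    have := hu i
    nlinarith
  have hy (i : Fin p) : (spreadPos e q u + 1) i =
      e + 2 * (((2 * (i : ℕ) + 1) * q + u i : ℕ) : ℤ) := by
    simp [spreadPos]
  have hyr (i : Fin p) : (((spreadPos e q u + 1) i : ℤ) : ℝ) =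
      e + 2 * (((2 * (i : ℕ) + 1) * q + u i : ℕ) : ℝ) := by
    rw [hy]; push_cast; ring
  have hzr (i : Fin p) : (q : ℝ) ≤ (((2 * (i : ℕ) + 1) * q + u i : ℕ) : ℝ) := by
    exact_mod_cast hz i
  have he0 : (0 : ℝ) ≤ e := Nat.cast_nonneg e
  have hq0 : (0 : ℝ) ≤ q := Nat.cast_nonneg q
  refine mul_le_mul ?_ ?_ (by positivity) (Finset.prod_nonneg fun i _ => mul_nonneg (sq_nonneg _)
    (mul_nonneg (walkCount_nonneg _ _) (walkCount_nonneg _ _)))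
  · rw [← mul_pow]
    calc _ = ∏ _i : Fin p, (walkCount (m + 2 * (p - 1) + 1) e *
          walkCount (m' + 2 * (p - 1) + 1) e * ((2 * q : ℝ) ^ 2 / 4)) := by simp
      _ ≤ _ := Finset.prod_le_prod (fun i _ => mul_nonneg (mul_nonneg
        (walkCount_nonneg _ _) (walkCount_nonneg _ _)) (by positivity)) fun i _ => ?_
    have h1 := walkCount_ge_half he hq hp (hz2 i) hM
    have h2 := walkCount_ge_half he hq hp (hz2 i) hM'
    have h3 := mul_le_mul h1 h2 (div_nonneg (walkCount_nonneg _ _) two_pos.le)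
      (walkCount_nonneg _ _)
    rw [← hy] at h3
    have h4 : (2 * q : ℝ) ^ 2 ≤ (((spreadPos e q u + 1) i : ℤ) : ℝ) ^ 2 := by
      refine pow_le_pow_left₀ (by positivity) ?_ 2
      rw [hyr]; linarith [hzr i]
    refine le_trans (le_of_eq ?_) (mul_le_mul h4 h3 (mul_nonneg
      (div_nonneg (walkCount_nonneg _ _) two_pos.le)
      (div_nonneg (walkCount_nonneg _ _) two_pos.le)) (sq_nonneg _))
    ring
  · refine pow_le_pow_left₀ (by positivity) ?_ 2
    rw [← prod_pairs_const]
    refine Finset.prod_le_prod (fun i _ => by positivity) fun i _ =>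
      Finset.prod_le_prod (fun j _ => by positivity) fun j hj => ?_
    have h1 : (((2 * (i : ℕ) + 1) * q + u i : ℕ) : ℝ) + q ≤
        (((2 * (j : ℕ) + 1) * q + u j : ℕ) : ℝ) := by
      exact_mod_cast spreadPos_gap hu (Finset.mem_Ioi.1 hj)
    have h2 := hzr i
    rw [hyr, hyr]
    nlinarith

/-- Comparison of the probability that the branches of a watermelon at time `m` lie below `L`
with the total number of watermelons. -/
lemma card_melon_below_le {p n m m' q : ℕ} (hp : 1 ≤ p) (hm : m + m' = 2 * n) (hq : 1 ≤ q)
    (hM : 48 * (p * q) ^ 2 ≤ m + 2 * (p - 1) + 1)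
    (hM' : 48 * (p * q) ^ 2 ≤ m' + 2 * (p - 1) + 1)
    {L : Fin p → ℝ} {Y : ℝ} (hL : ∀ i, 1 ≤ L i) (hLY : ∀ i, L i ≤ Y) :
    (Nat.card {w : Fin p → ℕ → ℤ // IsMelonW p n w ∧ ∀ i, (w i m : ℝ) + 1 ≤ L i} : ℝ) *
        ((q : ℝ) ^ p * (((2 * q : ℝ) ^ 2 / 4) ^ p * (((2 * q : ℝ) ^ 2) ^ pairCount p) ^ 2)) ≤
      (∏ i, L i) ^ 3 * ((Y ^ 2) ^ pairCount p) ^ 2 *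
        Nat.card {w : Fin p → ℕ → ℤ // IsMelonW p n w} := by
  classical
  have hfin := finite_isMelonW p n
  obtain ⟨κ, hκ, hN⟩ := exists_starCount_eq p m
  obtain ⟨κ', hκ', hN'⟩ := exists_starCount_eq p m'
  obtain ⟨e, he, hem⟩ : ∃ e : ℕ, e ≤ 1 ∧ (m + 1 + e) % 2 = 0 :=
    ⟨(m + 1) % 2, by omega, by omega⟩
  set B := (walkCount (m + 2 * (p - 1) + 1) e * walkCount (m' + 2 * (p - 1) + 1) e) ^ p with hB
  have hB0 : 0 ≤ B := pow_nonneg (mul_nonneg (walkCount_nonneg _ _) (walkCount_nonneg _ _)) _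
  have hBpos : 0 < B := by
    refine pow_pos (mul_pos (walkCount_pos _ _ ?_ ?_ ?_) (walkCount_pos _ _ ?_ ?_ ?_)) _ <;>
      push_cast <;> omega
  have hprod : 0 ≤ ∏ i, L i := Finset.prod_nonneg fun i _ => zero_le_one.trans (hL i)
  let T : Finset (Fin p → ℤ) := Fintype.piFinset fun i => Finset.Icc 0 ⌊L i - 1⌋
  let S : Finset (Fin p → ℤ) :=
    (Fintype.piFinset fun _ : Fin p => Finset.range q).image (spreadPos e q)
  have hT : (T.card : ℝ) ≤ ∏ i, L i := by
    rw [Fintype.card_piFinset]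
    push_cast
    refine Finset.prod_le_prod (fun i _ => by positivity) fun i _ => ?_
    have h0 : 0 ≤ ⌊L i - 1⌋ := Int.floor_nonneg.2 (by linarith [hL i])
    have h1 := Int.floor_le (L i - 1)
    rw [Int.card_Icc, sub_zero]
    have h2 : (((⌊L i - 1⌋ + 1).toNat : ℕ) : ℝ) = ((⌊L i - 1⌋ + 1 : ℤ) : ℝ) := by
      exact_mod_cast Int.toNat_of_nonneg (by omega)
    rw [h2]; push_cast; linarith
  have hS : (S.card : ℝ) = (q : ℝ) ^ p := by
    rw [Finset.card_image_of_injective _ (spreadPos_injective e q), Fintype.card_piFinset]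
    simp
  have upper : (Nat.card {w : Fin p → ℕ → ℤ //
      IsMelonW p n w ∧ ∀ i, (w i m : ℝ) + 1 ≤ L i} : ℝ) ≤
      κ * κ' * B * ((∏ i, L i) ^ 3 * ((Y ^ 2) ^ pairCount p) ^ 2) := by
    have hfin' : Finite {w : Fin p → ℕ → ℤ // IsMelonW p n w ∧ (fun i => w i m) ∈ T} :=
      Finite.of_injective (fun w => (⟨w.1, w.2.1⟩ : {w // IsMelonW p n w}))
        fun w v h => Subtype.ext (by simpa using h)
    have h1 : Nat.card {w : Fin p → ℕ → ℤ // IsMelonW p n w ∧ ∀ i, (w i m : ℝ) + 1 ≤ L i} ≤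
        Nat.card {w : Fin p → ℕ → ℤ // IsMelonW p n w ∧ (fun i => w i m) ∈ T} := by
      refine Nat.card_le_card_of_injective (Subtype.map id fun w hw => ⟨hw.1, ?_⟩)
        (Subtype.map_injective _ Function.injective_id)
      refine Fintype.mem_piFinset.2 fun i => Finset.mem_Icc.2
        ⟨hw.1.1.2.2.1 i m (by omega), Int.le_floor.2 (le_sub_iff_add_le.2 (hw.2 i))⟩
    rw [card_melon_position_mem p n m m' hm] at h1
    have h2 : (Nat.card {w : Fin p → ℕ → ℤ //
        IsMelonW p n w ∧ ∀ i, (w i m : ℝ) + 1 ≤ L i} : ℝ) ≤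
        ∑ x ∈ T, (starCount p m x : ℝ) * starCount p m' x := by exact_mod_cast h1
    refine h2.trans ((Finset.sum_le_card_nsmul T _
      (κ * κ' * B * ((∏ i, L i) ^ 2 * ((Y ^ 2) ^ pairCount p) ^ 2)) fun x hx => ?_).trans ?_)
    · by_cases hc : Chamber x ∧ ∀ i, (x i - m) % 2 = 0
      · rw [hN x hc.1 hc.2, hN' x hc.1 fun i => by have := hc.2 i; omega]
        have := starWeight_mul_le (m' := m') he hem hc.1 hc.2 (L := L) (fun i => by
          have := Int.le_floor.1 (Finset.mem_Icc.1 (Fintype.mem_piFinset.1 hx i)).2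
          linarith) hLY
        rw [← hB] at this
        have h5 := mul_le_mul_of_nonneg_left this (mul_pos hκ hκ').le
        linarith
      · rw [starCount_eq_zero hc]
        simp only [Nat.cast_zero, zero_mul]
        positivity
    · rw [nsmul_eq_mul]
      have h6 : 0 ≤ κ * κ' * B * ((∏ i, L i) ^ 2 * ((Y ^ 2) ^ pairCount p) ^ 2) := by positivity
      refine (mul_le_mul_of_nonneg_right hT h6).trans (le_of_eq (by ring))
  have lower : κ * κ' * B * ((q : ℝ) ^ p *
      (((2 * q : ℝ) ^ 2 / 4) ^ p * (((2 * q : ℝ) ^ 2) ^ pairCount p) ^ 2)) ≤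
      Nat.card {w : Fin p → ℕ → ℤ // IsMelonW p n w} := by
    have h1 : Nat.card {w : Fin p → ℕ → ℤ // IsMelonW p n w ∧ (fun i => w i m) ∈ S} ≤
        Nat.card {w : Fin p → ℕ → ℤ // IsMelonW p n w} :=
      Nat.card_le_card_of_injective (Subtype.map id fun w hw => hw.1)
        (Subtype.map_injective _ Function.injective_id)
    rw [card_melon_position_mem p n m m' hm] at h1
    have h2 : ∑ x ∈ S, (starCount p m x : ℝ) * starCount p m' x ≤
        Nat.card {w : Fin p → ℕ → ℤ // IsMelonW p n w} := by exact_mod_cast h1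
    refine le_trans ?_ ((Finset.card_nsmul_le_sum S _
      (κ * κ' * (B * (((2 * q : ℝ) ^ 2 / 4) ^ p * (((2 * q : ℝ) ^ 2) ^ pairCount p) ^ 2)))
        fun x hx => ?_).trans h2)
    · rw [nsmul_eq_mul, hS]
      exact le_of_eq (by ring)
    · obtain ⟨u, hu, rfl⟩ := Finset.mem_image.1 hx
      have hu' (i) : u i < q := Finset.mem_range.1 (Fintype.mem_piFinset.1 hu i)
      have hc := chamber_spreadPos (e := e) hq hu'
      have hpar (i) : (spreadPos e q u i - m) % 2 = 0 := by
        simp only [spreadPos]; omega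
      rw [hN _ hc hpar, hN' _ hc fun i => by have := hpar i; omega]
      have := mul_le_mul_of_nonneg_left (le_starWeight_mul hp he hq hu' hM hM')
        (mul_pos hκ hκ').le
      rw [← hB] at this
      linarith
  have hk : 0 < κ * κ' * B := by positivity
  have hY : 0 ≤ (∏ i, L i) ^ 3 * ((Y ^ 2) ^ pairCount p) ^ 2 := by positivity
  have h1 := mul_le_mul_of_nonneg_right upper (show (0 : ℝ) ≤ (q : ℝ) ^ p *
    (((2 * q : ℝ) ^ 2 / 4) ^ p * (((2 * q : ℝ) ^ 2) ^ pairCount p) ^ 2) by positivity)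
  have h2 := mul_le_mul_of_nonneg_left lower hY
  refine h1.trans (le_trans (le_of_eq ?_) h2)
  ring

lemma probW_le_one (p n : ℕ) (E : (Fin p → ℕ → ℤ) → Prop) : probW p n E ≤ 1 := by
  have := finite_isMelonW p n
  refine div_le_one_of_le₀ ?_ (Nat.cast_nonneg _)
  have h : Nat.card {w : Fin p → ℕ → ℤ // IsMelonW p n w ∧ E w} ≤
      Nat.card {w : Fin p → ℕ → ℤ // IsMelonW p n w} :=
    Nat.card_le_card_of_injective (Subtype.map id fun w hw => hw.1)
      (Subtype.map_injective _ Function.injective_id)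
  exact_mod_cast h

/-- The lowest branch of a watermelon is unlikely to be low. -/
lemma exists_card_melon_low_branch_le (p : ℕ) (hp : 1 ≤ p) (ε : ℝ) (hε0 : 0 < ε) (R : ℝ)
    (hR : 2 ≤ R) : ∃ c > (0 : ℝ), ∃ a > (0 : ℝ), ∀ n m m' : ℕ, m + m' = 2 * n →
      2 * n * ε ≤ m + 1 → 2 * n * ε ≤ m' + 1 → 1 ≤ a * √n →
      ∀ A : ℝ, 1 ≤ A → A ≤ √n →
      (Nat.card {w : Fin p → ℕ → ℤ // IsMelonW p n w ∧
        ∀ i, (w i m : ℝ) + 1 ≤ if i = ⟨0, hp⟩ then 2 * A else R * √n} : ℝ) ≤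
      c * (A / √n) ^ 3 * Nat.card {w : Fin p → ℕ → ℤ // IsMelonW p n w} := by
  have hp0 : (0 : ℝ) < p := by exact_mod_cast hp
  set a : ℝ := √(ε / 24) / p with ha
  have ha0 : 0 < a := by positivity
  have hR0 : 0 < R := by linarith
  refine ⟨8 / R ^ 3 * (R / a) ^ (p + 2 * p + 4 * pairCount p) * 8 ^ p, by positivity, a, ha0,
    fun n m m' hm hmε hmε' han A hA hAn => ?_⟩
  set s := √(n : ℝ) with hs
  have hs1 : 1 ≤ s := hA.trans hAn
  have hs0 : 0 < s := by linarith
  set q := ⌊a * s⌋₊ with hq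
  have hq1 : 1 ≤ q := Nat.le_floor (by exact_mod_cast han)
  have hqle : (q : ℝ) ≤ a * s := Nat.floor_le (by positivity)
  have hqge : a * s ≤ 2 * q := by
    have h1 := Nat.lt_floor_add_one (a * s)
    have h2 : (1 : ℝ) ≤ q := by exact_mod_cast hq1
    rw [← hq] at h1
    linarith
  have hpq : 48 * ((p : ℝ) * q) ^ 2 ≤ 2 * n * ε := by
    calc 48 * ((p : ℝ) * q) ^ 2 ≤ 48 * ((p : ℝ) * (a * s)) ^ 2 := by gcongr
      _ = 48 * (√(ε / 24)) ^ 2 * s ^ 2 := by rw [ha]; field_simp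
      _ = 2 * n * ε := by
        rw [Real.sq_sqrt (by positivity), hs, Real.sq_sqrt (Nat.cast_nonneg n)]; ring
  have hbound (k : ℕ) (hk : 2 * n * ε ≤ (k : ℝ) + 1) :
      48 * (p * q) ^ 2 ≤ k + 2 * (p - 1) + 1 := by
    have h1 : 48 * (p * q) ^ 2 ≤ k + 1 := by exact_mod_cast hpq.trans hk
    omega
  have key := card_melon_below_le (L := fun i => if i = ⟨0, hp⟩ then 2 * A else R * s)
    (Y := R * s) hp hm hq1 (hbound m hmε) (hbound m' hmε')
    (fun i => by split_ifs <;> nlinarith)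
    (fun i => by split_ifs <;> nlinarith)
  have hprod : (∏ i : Fin p, if i = ⟨0, hp⟩ then 2 * A else R * s) =
      (R * s) ^ p * (2 * A / (R * s)) := by
    have (i : Fin p) : (if i = ⟨0, hp⟩ then 2 * A else R * s) =
        R * s * if i = ⟨0, hp⟩ then 2 * A / (R * s) else 1 := by
      split_ifs
      · field_simp
      · ring
    simp only [this, Finset.prod_mul_distrib, Finset.prod_const, Finset.card_univ,
      Fintype.card_fin, Finset.prod_ite_eq', Finset.mem_univ, if_true, mul_pow]
  rw [hprod] at key
  set D : ℝ := (a * s / 2) ^ p * (((a * s) ^ 2 / 4) ^ p * (((a * s) ^ 2) ^ pairCount p) ^ 2)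
    with hD
  have hDpos : 0 < D := by positivity
  have hDle : D ≤ (q : ℝ) ^ p *
      (((2 * q : ℝ) ^ 2 / 4) ^ p * (((2 * q : ℝ) ^ 2) ^ pairCount p) ^ 2) := by
    have : a * s / 2 ≤ q := by linarith
    rw [hD]
    gcongr
  have hid : ((R * s) ^ p * (2 * A / (R * s))) ^ 3 * (((R * s) ^ 2) ^ pairCount p) ^ 2 =
      8 / R ^ 3 * (R / a) ^ (p + 2 * p + 4 * pairCount p) * 8 ^ p * (A / s) ^ 3 * D := by
    have e1 : ((R * s) ^ p * (2 * A / (R * s))) ^ 3 * (((R * s) ^ 2) ^ pairCount p) ^ 2 =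
        (2 * A / (R * s)) ^ 3 * (R * s) ^ (p + 2 * p + 4 * pairCount p) := by
      ring
    have e2 : D * 8 ^ p = (a * s) ^ (p + 2 * p + 4 * pairCount p) := by
      have : (8 : ℝ) ^ p = 2 ^ p * 4 ^ p := by rw [← mul_pow]; norm_num
      rw [hD, this, div_pow, div_pow]
      field_simp
      ring
    have e3 : (R * s) ^ (p + 2 * p + 4 * pairCount p) =
        (R / a) ^ (p + 2 * p + 4 * pairCount p) * (a * s) ^ (p + 2 * p + 4 * pairCount p) := by
      rw [← mul_pow]; congr 1; field_simp
    rw [e1, e3, ← e2]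
    field_simp
    ring
  rw [hid] at key
  have h1 := (mul_le_mul_of_nonneg_left hDle (Nat.cast_nonneg _)).trans key
  refine le_of_mul_le_mul_right (h1.trans (le_of_eq ?_)) hDpos
  ring

/-- the probability that two consecutive branches have squared
positions within `n^α` of each other while all branches are below `r·√(2n)` at
time `⌊2nt⌋` is `O(n^{3(α−1/2)})`, uniformly in `t ∈ [ε, 1−ε]`. Branches are
1-indexed in the paper: `W_j` is branch number `j`, i.e. index `j−1` here. -/
theorem melonW_close_branches_small_prob (p : ℕ) (hp : 2 ≤ p)
    (j : ℕ) (hj1 : 1 ≤ j) (hj2 : j ≤ p - 1)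
    (ε : ℝ) (hε0 : 0 < ε) (hε : ε < 1 / 2) (r : ℝ) (hr : 0 < r)
    (α : ℝ) (hα0 : 0 < α) (hα : α < 1 / 4) :
    ∃ c > (0 : ℝ), ∀ n : ℕ, 1 ≤ n → ∀ t : ℝ, ε ≤ t → t ≤ 1 - ε →
      probW p n (fun w =>
          ((w ⟨j, by omega⟩ ⌊2 * (n : ℝ) * t⌋₊ : ℝ)) ^ 2
              - ((w ⟨j - 1, by omega⟩ ⌊2 * (n : ℝ) * t⌋₊ : ℝ)) ^ 2 ≤ (n : ℝ) ^ α ∧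
          (w ⟨p - 1, by omega⟩ ⌊2 * (n : ℝ) * t⌋₊ : ℝ) ≤ r * Real.sqrt (2 * n))
        ≤ c * (n : ℝ) ^ (3 * (α - 1 / 2)) := by
  obtain ⟨c, hc, a, ha, key⟩ := exists_card_melon_low_branch_le p (by omega) ε hε0
    (√2 * r + 2) (by nlinarith [Real.sqrt_nonneg 2])
  refine ⟨c + (a⁻¹) ^ 3, by positivity, fun n hn t ht1 ht2 => ?_⟩
  have hn1 : (1 : ℝ) ≤ n := by exact_mod_cast hn
  have hn0 : (0 : ℝ) < n := by linarith
  have hs : 1 ≤ √(n : ℝ) := Real.one_le_sqrt.2 hn1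
  have hA1 : 1 ≤ (n : ℝ) ^ α := Real.one_le_rpow hn1 hα0.le
  have hAs : (n : ℝ) ^ α ≤ √n := by
    rw [Real.sqrt_eq_rpow]; exact Real.rpow_le_rpow_of_exponent_le hn1 (by linarith)
  have hpow : (n : ℝ) ^ (3 * (α - 1 / 2)) = ((n : ℝ) ^ α / √n) ^ 3 := by
    rw [mul_comm, Real.rpow_mul hn0.le, Real.rpow_sub hn0, Real.sqrt_eq_rpow]
    norm_cast
  rw [hpow, add_mul]
  rcases lt_or_ge (a * √(n : ℝ)) 1 with hsmall | hlarge
  · refine (probW_le_one _ _ _).trans ?_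
    have h1 : 1 ≤ a⁻¹ ^ 3 * ((n : ℝ) ^ α / √n) ^ 3 := by
      rw [← mul_pow]
      refine one_le_pow₀ ?_
      rw [inv_mul_eq_div, le_div_iff₀ ha, le_div_iff₀ (by linarith)]
      linarith
    have h2 : 0 ≤ c * ((n : ℝ) ^ α / √n) ^ 3 := by positivity
    linarith
  · set m := ⌊2 * (n : ℝ) * t⌋₊ with hm
    have ht0 : 0 ≤ 2 * (n : ℝ) * t := mul_nonneg (by positivity) (by linarith)
    have hm1 : (m : ℝ) ≤ 2 * n * t := Nat.floor_le ht0
    have hm2 : 2 * (n : ℝ) * t < m + 1 := Nat.lt_floor_add_one _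
    have hmn : m ≤ 2 * n := by
      have : (m : ℝ) ≤ 2 * n := by nlinarith
      exact_mod_cast this
    obtain ⟨m', hm'⟩ := Nat.exists_eq_add_of_le hmn
    have hm'r : (m : ℝ) + m' = 2 * n := by exact_mod_cast hm'.symm
    have h1 := key n m m' hm'.symm (by nlinarith) (by nlinarith) hlarge _ hA1 hAs
    have hfin := finite_isMelonW p n
    have h2 : probW p n (fun w => ((w ⟨j, by omega⟩ m : ℝ)) ^ 2 -
        ((w ⟨j - 1, by omega⟩ m : ℝ)) ^ 2 ≤ (n : ℝ) ^ α ∧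
          (w ⟨p - 1, by omega⟩ m : ℝ) ≤ r * √(2 * n)) ≤ c * ((n : ℝ) ^ α / √n) ^ 3 := by
      refine div_le_of_le_mul₀ (Nat.cast_nonneg _) (by positivity) (le_trans ?_ h1)
      have hfin' : Finite {w : Fin p → ℕ → ℤ // IsMelonW p n w ∧ ∀ i, (w i m : ℝ) + 1 ≤
          if i = ⟨0, by omega⟩ then 2 * (n : ℝ) ^ α else (√2 * r + 2) * √n} :=
        Finite.of_injective (fun w => (⟨w.1, w.2.1⟩ : {w // IsMelonW p n w}))
          fun w v h => Subtype.ext (by simpa using h)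
      rw [Nat.cast_le]
      refine Nat.card_le_card_of_injective (Subtype.map id fun w hw => ⟨hw.1, fun i => ?_⟩)
        (Subtype.map_injective _ Function.injective_id)
      obtain ⟨hw, hclose, hlow⟩ := hw
      obtain ⟨hpos, hmono⟩ := chamber_of_isStarW hw.1 hmn
      simp only [id]
      split_ifs with hi
      · have h3 : w i m ≤ w ⟨j - 1, by omega⟩ m :=
          hmono.monotone (by rw [hi]; exact Nat.zero_le _)
        have h4 : w ⟨j - 1, by omega⟩ m + 1 ≤ w ⟨j, by omega⟩ m :=
          hmono (a := ⟨j - 1, by omega⟩) (b := ⟨j, by omega⟩) (by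
            simp only [Fin.mk_lt_mk]; omega)
        have h5 : 0 ≤ w ⟨j - 1, by omega⟩ m := hpos _
        have h3' : (w i m : ℝ) ≤ w ⟨j - 1, by omega⟩ m := by exact_mod_cast h3
        have h4' : (w ⟨j - 1, by omega⟩ m : ℝ) + 1 ≤ w ⟨j, by omega⟩ m := by exact_mod_cast h4
        have h5' : (0 : ℝ) ≤ w ⟨j - 1, by omega⟩ m := by exact_mod_cast h5
        nlinarith
      · have h3 : w i m ≤ w ⟨p - 1, by omega⟩ m :=
          hmono.monotone (by have := i.2; exact Fin.mk_le_mk.2 (by omega))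
        have h3' : (w i m : ℝ) ≤ w ⟨p - 1, by omega⟩ m := by exact_mod_cast h3
        rw [Real.sqrt_mul zero_le_two] at hlow
        nlinarith
    have h3 : 0 ≤ a⁻¹ ^ 3 * ((n : ℝ) ^ α / √n) ^ 3 := by positivity
    linarith
end

section
/- Fix an integer p ≥ 2, an index j ∈ {1,…,p−1}, ε ∈ (0,1/2), r > 0, and α ∈ (0,1/4). Then there exists a constant c > 0 such that for every integer n ≥ 1 and every t ∈ [ε, 1−ε], the probability, under the uniform distribution on (p,2n)-watermelons without wall condition, of the event { Ŵ_{j+1}(⌊2nt⌋) − Ŵ_j(⌊2nt⌋) ≤ n^α and |Ŵ_i(⌊2nt⌋)| ≤ r·√(2n) for all i } is at most c · n^{3(α − 1/2)}. -/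
open MeasureTheory Filter

/-- A star of length `m` without wall condition, with `p` branches, encoded as a
function `Fin p → ℕ → ℤ` (values beyond time `m` are pinned to `0` so that the
collection of stars is a finite set). Branch `i` (0-indexed) starts at `2i`. -/
def IsStarNW (p m : ℕ) (w : Fin p → ℕ → ℤ) : Prop :=
  (∀ i : Fin p, w i 0 = 2 * ((i : ℕ) : ℤ)) ∧
  (∀ i : Fin p, ∀ k, k < m → (w i (k + 1) - w i k = 1 ∨ w i (k + 1) - w i k = -1)) ∧
  (∀ i j : Fin p, i < j → ∀ k, k ≤ m → w i k < w j k) ∧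
  (∀ i : Fin p, ∀ k, m < k → w i k = 0)

/-- A `(p,2n)`-watermelon without wall condition. -/
def IsMelonNW (p n : ℕ) (w : Fin p → ℕ → ℤ) : Prop :=
  IsStarNW p (2 * n) w ∧ ∀ i : Fin p, w i (2 * n) = 2 * ((i : ℕ) : ℤ)

/-- Probability of the event `E` under the uniform distribution on
`(p,2n)`-watermelons without wall condition. -/
noncomputable def probNW (p n : ℕ) (E : (Fin p → ℕ → ℤ) → Prop) : ℝ :=
  (Nat.card {w : Fin p → ℕ → ℤ // IsMelonNW p n w ∧ E w} : ℝ) /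
    (Nat.card {w : Fin p → ℕ → ℤ // IsMelonNW p n w} : ℝ)

/-- Binomial coefficient with an integer lower argument. -/
def intChoose (m : ℕ) (z : ℤ) : ℤ := if 0 ≤ z then (m.choose z.toNat : ℤ) else 0

lemma intChoose_natCast (m a : ℕ) : intChoose m a = m.choose a := by
  simp [intChoose]

lemma intChoose_of_neg (m : ℕ) {z : ℤ} (hz : z < 0) : intChoose m z = 0 := by
  simp [intChoose, hz]

lemma intChoose_of_lt (m : ℕ) {z : ℤ} (hz : (m : ℤ) < z) : intChoose m z = 0 := by
  lift z to ℕ using by omega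
  rw [intChoose_natCast, Nat.choose_eq_zero_of_lt (by omega), Nat.cast_zero]

lemma intChoose_zero (z : ℤ) : intChoose 0 z = if z = 0 then 1 else 0 := by
  rcases lt_trichotomy z 0 with h | h | h
  · rw [intChoose_of_neg 0 h, if_neg h.ne]
  · simp [h, intChoose]
  · rw [intChoose_of_lt 0 (by exact_mod_cast h), if_neg h.ne']

lemma intChoose_succ (m : ℕ) (z : ℤ) :
    intChoose (m + 1) z = intChoose m z + intChoose m (z - 1) := by
  rcases lt_or_ge z 0 with h | h
  · simp [intChoose_of_neg _ h, intChoose_of_neg _ (show z - 1 < 0 by omega)]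
  · lift z to ℕ using h
    rcases z with _ | a
    · simp [intChoose]
    · rw [show ((a + 1 : ℕ) : ℤ) - 1 = (a : ℤ) by push_cast; ring]
      simp only [intChoose_natCast, Nat.choose_succ_succ]
      push_cast
      ring

/-- The determinant counting the stars of length `m` whose `j`-th branch has made `b j - j`
up-steps. -/
def starDet (p m : ℕ) (b : Fin p → ℤ) : ℤ :=
  Matrix.det (Matrix.of fun j i : Fin p => intChoose m (b j - ((i : ℕ) : ℤ)))

/-- The stars of length `m` whose `j`-th branch has made `b j - j` up-steps. -/
def starSet (p m : ℕ) (b : Fin p → ℤ) : Set (Fin p → ℕ → ℤ) :=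
  {w | IsStarNW p m w ∧ ∀ i, w i m = 2 * b i - m}

lemma starDet_succ (p m : ℕ) (b : Fin p → ℤ) :
    starDet p (m + 1) b = ∑ s : Finset (Fin p), starDet p m (s.piecewise b (fun i => b i - 1)) := by
  have h := (Matrix.detRowAlternating (n := Fin p) (R := ℤ)).map_add_univ
    (fun j i : Fin p => intChoose m (b j - ((i : ℕ) : ℤ)))
    (fun j i : Fin p => intChoose m (b j - 1 - ((i : ℕ) : ℤ)))
  have h1 : starDet p (m + 1) b = (Matrix.detRowAlternating (n := Fin p) (R := ℤ))
      ((fun j i : Fin p => intChoose m (b j - ((i : ℕ) : ℤ))) +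
        (fun j i : Fin p => intChoose m (b j - 1 - ((i : ℕ) : ℤ)))) := by
    change _ = Matrix.det _
    rw [starDet]
    congr 1
    ext j i
    simp only [Matrix.of_apply, Pi.add_apply, intChoose_succ]
    rw [sub_right_comm]
  rw [h1, h]
  refine Finset.sum_congr rfl fun s _ => ?_
  change Matrix.det _ = _
  rw [starDet]
  congr 1
  ext j i
  by_cases hj : j ∈ s <;> simp [Finset.piecewise, hj]

lemma starDet_eq_zero_of_not_strictMono {p m : ℕ} {b : Fin p → ℤ} (hb : Monotone b)
    (hb' : ¬ StrictMono b) : starDet p m b = 0 := by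
  have : ¬ Function.Injective b := fun h => hb' (hb.strictMono_of_injective h)
  simp only [Function.Injective, not_forall] at this
  obtain ⟨i, j, hij, hne⟩ := this
  exact Matrix.det_zero_of_row_eq hne (by ext k; simp [hij])

lemma starSet_eq_empty_of_not_strictMono {p m : ℕ} {b : Fin p → ℤ} (hb' : ¬ StrictMono b) :
    starSet p m b = ∅ := by
  refine Set.eq_empty_of_forall_notMem fun w hw => hb' fun i j hij => ?_
  have := hw.1.2.2.1 i j hij m le_rfl
  rw [hw.2 i, hw.2 j] at this
  omega

lemma starSet_zero_of_ne {p : ℕ} {b : Fin p → ℤ} (hb : b ≠ fun i : Fin p => ((i : ℕ) : ℤ)) :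
    starSet p 0 b = ∅ := by
  refine Set.eq_empty_of_forall_notMem fun w hw => hb ?_
  ext i
  have := hw.1.1 i
  rw [hw.2 i] at this
  push_cast at this
  omega

lemma starSet_zero (p : ℕ) :
    starSet p 0 (fun i : Fin p => ((i : ℕ) : ℤ)) =
      {fun (i : Fin p) (k : ℕ) => if k = 0 then 2 * ((i : ℕ) : ℤ) else 0} := by
  ext w
  simp only [starSet, IsStarNW, Set.mem_ofPred_eq, Set.mem_singleton_iff]
  constructor
  · rintro ⟨⟨h0, -, -, h1⟩, -⟩
    ext i k
    rcases Nat.eq_zero_or_pos k with rfl | hk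
    · simp [h0]
    · simp [h1 i k hk, hk.ne']
  · rintro rfl
    refine ⟨⟨by simp, by simp, ?_, ?_⟩, by simp⟩
    · intro i j hij k hk
      have : (i : ℕ) < j := hij
      obtain rfl : k = 0 := by omega
      simp [hij]
    · intro i k hk
      simp [hk.ne']

lemma starDet_zero (p : ℕ) : starDet p 0 (fun i : Fin p => ((i : ℕ) : ℤ)) = 1 := by
  rw [starDet, ← Matrix.det_one (n := Fin p)]
  congr 1
  ext i j
  simp only [Matrix.of_apply, intChoose_zero, Matrix.one_apply]
  congr 1
  simp [sub_eq_zero, Fin.ext_iff]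

lemma eq_val_of_strictMono {p : ℕ} {b : Fin p → ℤ} (hb : StrictMono b)
    (h : ∀ i, ∃ k : Fin p, b i = ((k : ℕ) : ℤ)) : b = fun i : Fin p => ((i : ℕ) : ℤ) := by
  choose f hf using h
  have hf' : StrictMono f := fun i j hij => by
    have := hb hij
    rw [hf i, hf j] at this
    exact_mod_cast this
  have : f = id := by
    have h1 := Subsingleton.elim (hf'.orderIsoOfSurjective f
      (Finite.surjective_of_injective hf'.injective)) (OrderIso.refl (Fin p))
    ext i
    exact congrArg (fun g : Fin p ≃o Fin p => ((g i : Fin p) : ℕ)) h1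
  ext i
  rw [hf i, this, id]

lemma starDet_zero_of_ne {p : ℕ} {b : Fin p → ℤ} (hb : StrictMono b)
    (hne : b ≠ fun i : Fin p => ((i : ℕ) : ℤ)) : starDet p 0 b = 0 := by
  have : ∃ i, ∀ k : Fin p, b i ≠ ((k : ℕ) : ℤ) := by
    by_contra! h
    exact hne (eq_val_of_strictMono hb h)
  obtain ⟨i, hi⟩ := this
  refine Matrix.det_eq_zero_of_row_eq_zero i fun k => ?_
  rw [Matrix.of_apply, intChoose_zero, if_neg (sub_ne_zero.2 (hi k))]

/-- Prescribes the positions of the branches at time `m + 1` to be `2 * b i - (m + 1)`. -/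
def extendStar (p m : ℕ) (b : Fin p → ℤ) (w : Fin p → ℕ → ℤ) : Fin p → ℕ → ℤ :=
  fun i k => if k = m + 1 then 2 * b i - ((m + 1 : ℕ) : ℤ) else w i k

lemma starSet_succ {p m : ℕ} {b : Fin p → ℤ} (hb : StrictMono b) :
    starSet p (m + 1) b = extendStar p m b ''
      ⋃ s : Finset (Fin p), starSet p m (s.piecewise b (fun i => b i - 1)) := by
  classical
  ext w
  simp only [Set.mem_image, Set.mem_iUnion]
  constructor
  · rintro ⟨⟨h0, h1, h2, h3⟩, h4⟩
    refine ⟨fun i k => if k = m + 1 then 0 else w i k,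
      ⟨Finset.univ.filter fun i => w i (m + 1) - w i m = -1, ⟨⟨?_, ?_, ?_, ?_⟩, ?_⟩⟩, ?_⟩
    · intro i
      simp [h0]
    · intro i k hk
      simp only
      rw [if_neg (by omega), if_neg (by omega)]
      exact h1 i k (by omega)
    · intro i j hij k hk
      simp only
      rw [if_neg (by omega), if_neg (by omega)]
      exact h2 i j hij k (by omega)
    · intro i k hk
      by_cases hk' : k = m + 1
      · simp [hk']
      · simp only [hk', if_false]
        exact h3 i k (by omega)
    · intro i
      have a1 := h1 i m (by omega)
      have a2 := h4 i
      push_cast at a2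
      simp only [Finset.piecewise, Finset.mem_filter, Finset.mem_univ, true_and,
        Nat.left_eq_add, one_ne_zero, if_false]
      split_ifs with hs <;> omega
    · ext i k
      simp only [extendStar]
      split_ifs with hk
      · rw [hk, h4 i]
      · rfl
  · rintro ⟨v, ⟨s, ⟨h0, h1, h2, h3⟩, h4⟩, rfl⟩
    have h5 : ∀ i, v i m = 2 * b i - m ∨ v i m = 2 * b i - 2 - m := by
      intro i
      rw [h4 i]
      by_cases hi : i ∈ s <;> simp [Finset.piecewise, hi]
      ring
    refine ⟨⟨?_, ?_, ?_, ?_⟩, ?_⟩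
    · intro i
      simp [extendStar, h0]
    · intro i k hk
      simp only [extendStar]
      rw [if_neg (show ¬ k = m + 1 by omega)]
      by_cases hk' : k + 1 = m + 1
      · obtain rfl : k = m := by omega
        rw [if_pos rfl]
        push_cast
        rcases h5 i with h | h <;> omega
      · rw [if_neg hk']
        exact h1 i k (by omega)
    · intro i j hij k hk
      simp only [extendStar]
      split_ifs with hk'
      · have := hb hij
        omega
      · exact h2 i j hij k (by omega)
    · intro i k hk
      simp only [extendStar]
      rw [if_neg (by omega)]
      exact h3 i k (by omega)
    · intro i
      simp [extendStar]

lemma extendStar_injOn (p m : ℕ) (b : Fin p → ℤ) :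
    Set.InjOn (extendStar p m b)
      (⋃ s : Finset (Fin p), starSet p m (s.piecewise b (fun i => b i - 1))) := by
  intro v hv w hw hvw
  simp only [Set.mem_iUnion] at hv hw
  obtain ⟨s, hv, -⟩ := hv
  obtain ⟨t, hw, -⟩ := hw
  ext i k
  by_cases hk : k = m + 1
  · rw [hv.2.2.2 i k (by omega), hw.2.2.2 i k (by omega)]
  · simpa [extendStar, hk] using congrFun (congrFun hvw i) k

lemma starSet_piecewise_disjoint (p m : ℕ) (b : Fin p → ℤ) :
    Pairwise (Function.onFun Disjoint fun s : Finset (Fin p) =>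
      starSet p m (s.piecewise b (fun i => b i - 1))) := by
  intro s t hst
  refine Set.disjoint_left.2 fun w hs ht => hst ?_
  ext i
  have h1 := hs.2 i
  have h2 := ht.2 i
  simp only [Finset.piecewise] at h1 h2
  split_ifs at h1 h2 with his hit hit
  · exact iff_of_true his hit
  · omega
  · omega
  · exact iff_of_false his hit

/-- The number of stars with given endpoints is a determinant of binomial coefficients. -/
lemma starSet_finite_and_ncard (p m : ℕ) : ∀ b : Fin p → ℤ, Monotone b →
    (starSet p m b).Finite ∧ ((starSet p m b).ncard : ℤ) = starDet p m b := by
  induction m with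
  | zero =>
    intro b hb
    by_cases hb' : StrictMono b
    · by_cases h : b = fun i : Fin p => ((i : ℕ) : ℤ)
      · rw [h, starSet_zero, starDet_zero]
        simp
      · rw [starSet_zero_of_ne h, starDet_zero_of_ne hb' h]
        simp
    · rw [starSet_eq_empty_of_not_strictMono hb', starDet_eq_zero_of_not_strictMono hb hb']
      simp
  | succ m ih =>
    intro b hb
    by_cases hb' : StrictMono b
    · have hmono : ∀ s : Finset (Fin p), Monotone (s.piecewise b (fun i => b i - 1)) := by
        intro s i j hij
        rcases hij.eq_or_lt with rfl | hij
        · rfl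
        · have := hb' hij
          simp only [Finset.piecewise]
          split_ifs <;> omega
      have hfin := fun s => (ih _ (hmono s)).1
      rw [starSet_succ hb']
      refine ⟨(Set.finite_iUnion hfin).image _, ?_⟩
      rw [(extendStar_injOn p m b).ncard_image,
        Set.ncard_iUnion_of_finite hfin (starSet_piecewise_disjoint p m b),
        finsum_eq_sum_of_fintype, starDet_succ]
      push_cast
      exact Finset.sum_congr rfl fun s _ => (ih _ (hmono s)).2
    · rw [starSet_eq_empty_of_not_strictMono hb', starDet_eq_zero_of_not_strictMono hb hb']
      simp

open Polynomial in
/-- The polynomial expressing the `i`-th entry of a row of `starDet`, up to a factor depending on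
the row only. -/
noncomputable def starPoly (p m : ℕ) (i : Fin p) : ℤ[X] :=
  descPochhammer ℤ i * (descPochhammer ℤ (p - 1 - i)).comp (C ((m + p - 1 : ℕ) : ℤ) - X)

lemma starPoly_eval (p m : ℕ) (i : Fin p) {a : ℕ} (ha : a ≤ m + p - 1) :
    (starPoly p m i).eval (a : ℤ) =
      ((a.descFactorial i * (m + p - 1 - a).descFactorial (p - 1 - i) : ℕ) : ℤ) := by
  rw [starPoly, Polynomial.eval_mul, Polynomial.eval_comp, Polynomial.eval_sub, Polynomial.eval_C,
    Polynomial.eval_X, ← Nat.cast_sub ha, descPochhammer_eval_eq_descFactorial,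
    descPochhammer_eval_eq_descFactorial, Nat.cast_mul]

lemma natDegree_starPoly_lt (p m : ℕ) (i : Fin p) : (starPoly p m i).natDegree < p := by
  have h1 := descPochhammer_natDegree ℤ (i : ℕ)
  have h2 := descPochhammer_natDegree ℤ (p - 1 - (i : ℕ))
  have h3 : (Polynomial.C ((m + p - 1 : ℕ) : ℤ) - Polynomial.X).natDegree ≤ 1 :=
    (Polynomial.natDegree_sub_le _ _).trans (by simp)
  have h4 : (starPoly p m i).natDegree ≤ i + (p - 1 - i) * 1 := by
    refine Polynomial.natDegree_mul_le.trans (add_le_add h1.le ?_)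
    refine Polynomial.natDegree_comp_le.trans ?_
    rw [h2]
    exact Nat.mul_le_mul_left _ h3
  have := i.2
  omega

lemma intChoose_mul_factorial {p m a i : ℕ} (hi : i < p) (ha : a ≤ m + p - 1) :
    ((a.factorial * (m + p - 1 - a).factorial : ℕ) : ℤ) * intChoose m ((a : ℤ) - i) =
      (m.factorial : ℤ) *
        ((a.descFactorial i * (m + p - 1 - a).descFactorial (p - 1 - i) : ℕ) : ℤ) := by
  rcases lt_or_ge a i with h | h
  · rw [intChoose_of_neg _ (by omega), Nat.descFactorial_of_lt h]
    simp
  obtain ⟨c, rfl⟩ := Nat.exists_eq_add_of_le h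
  rw [show ((i + c : ℕ) : ℤ) - i = (c : ℤ) by push_cast; ring, intChoose_natCast]
  rcases lt_or_ge m c with h' | h'
  · rw [Nat.choose_eq_zero_of_lt h', Nat.descFactorial_of_lt (by omega : m + p - 1 - (i + c) < _)]
    simp
  obtain ⟨d, rfl⟩ := Nat.exists_eq_add_of_le h'
  obtain ⟨e, rfl⟩ : ∃ e, p = i + e + 1 := ⟨p - i - 1, by omega⟩
  rw [show c + d + (i + e + 1) - 1 - (i + c) = e + d by omega,
    show i + e + 1 - 1 - i = e by omega]
  have h1 := Nat.factorial_mul_descFactorial (show i ≤ i + c by omega)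
  have h2 := Nat.factorial_mul_descFactorial (show e ≤ e + d by omega)
  have h3 := Nat.choose_mul_factorial_mul_factorial (show c ≤ c + d by omega)
  rw [Nat.add_sub_cancel_left] at h1 h2 h3
  rw [← h1, ← h2, ← h3]
  push_cast
  ring

lemma det_starPoly_eval_eq_mul (p m : ℕ) : ∃ κ : ℤ, ∀ v : Fin p → ℤ,
    (Matrix.of fun j i => (starPoly p m i).eval (v j)).det = (Matrix.vandermonde v).det * κ := by
  refine ⟨(Matrix.of fun k i : Fin p => (starPoly p m i).coeff k).det, fun v => ?_⟩
  rw [← Matrix.det_mul]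
  congr 1
  ext j i
  rw [Matrix.of_apply, Polynomial.eval_eq_sum_range' (natDegree_starPoly_lt p m i),
    Matrix.mul_apply, ← Fin.sum_univ_eq_sum_range (fun k => (starPoly p m i).coeff k * v j ^ k)]
  refine Finset.sum_congr rfl fun k _ => ?_
  rw [Matrix.vandermonde_apply, Matrix.of_apply, mul_comm]

lemma det_starPoly_eval_index (p m : ℕ) :
    (Matrix.of fun j i : Fin p => (starPoly p m i).eval ((j : ℕ) : ℤ)).det =
      ∏ i : Fin p, (((i : ℕ).factorial * (m + p - 1 - i).descFactorial (p - 1 - i) : ℕ) : ℤ) := by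
  rw [Matrix.det_of_isLowerTriangular]
  · refine Finset.prod_congr rfl fun i _ => ?_
    rw [Matrix.of_apply, starPoly_eval _ _ _ (by omega), Nat.descFactorial_self]
  · intro j i hij
    have hij' : (j : ℕ) < i := hij
    rw [Matrix.of_apply, starPoly_eval _ _ _ (by omega), Nat.descFactorial_of_lt hij']
    simp

lemma det_vandermonde_index (p : ℕ) :
    (Matrix.vandermonde fun i : Fin p => ((i : ℕ) : ℤ)).det =
      ∏ i : Fin p, ((i : ℕ).factorial : ℤ) := by
  rcases p with _ | q
  · simp
  · rw [Matrix.det_vandermonde_id_eq_superFactorial, ← Nat.prod_range_succ_factorial,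
      ← Fin.prod_univ_eq_prod_range (fun i => i.factorial)]
    push_cast
    rfl

lemma det_starPoly_eval (p m : ℕ) (v : Fin p → ℤ) :
    (m.factorial : ℤ) ^ p * (Matrix.of fun j i => (starPoly p m i).eval (v j)).det =
      (∏ j : Fin p, ((m + j).factorial : ℤ)) * (Matrix.vandermonde v).det := by
  obtain ⟨κ, hκ⟩ := det_starPoly_eval_eq_mul p m
  have h := hκ fun i : Fin p => ((i : ℕ) : ℤ)
  rw [det_starPoly_eval_index, det_vandermonde_index] at h
  push_cast at h
  rw [Finset.prod_mul_distrib] at h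
  have h0 : ∏ i : Fin p, ((i : ℕ).factorial : ℤ) ≠ 0 :=
    Finset.prod_ne_zero_iff.2 fun i _ => by exact_mod_cast (Nat.factorial_ne_zero _)
  have h1 := mul_left_cancel₀ h0 h
  rw [hκ v, ← h1, mul_left_comm, mul_comm (∏ j : Fin p, ((m + j).factorial : ℤ))]
  congr 1
  rw [← Fin.prod_const, ← Finset.prod_mul_distrib, ← Equiv.prod_comp Fin.revPerm]
  refine Finset.prod_congr rfl fun i _ => ?_
  have hi := i.2
  rw [Fin.revPerm_apply, Fin.val_rev, show m + p - 1 - (p - (i + 1)) = m + i by omega,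
    show p - 1 - (p - ((i : ℕ) + 1)) = i by omega,
    ← Nat.factorial_mul_descFactorial (show (i : ℕ) ≤ m + i by omega), Nat.add_sub_cancel]
  push_cast
  ring

/-- Product formula for the number of stars with given endpoints. -/
lemma starDet_mul_prod_factorial (p m : ℕ) (a : Fin p → ℕ) (ha : ∀ j, a j ≤ m + p - 1) :
    (∏ j, (((a j).factorial * (m + p - 1 - a j).factorial : ℕ) : ℤ)) *
        starDet p m (fun j => (a j : ℤ)) =
      (∏ j : Fin p, ((m + j).factorial : ℤ)) *
        (Matrix.vandermonde fun j => (a j : ℤ)).det := by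
  rw [starDet, ← Matrix.det_mul_column, ← det_starPoly_eval, ← Fin.prod_const,
    ← Matrix.det_mul_column]
  congr 1
  ext j i
  simp only [Matrix.of_apply]
  rw [intChoose_mul_factorial i.2 (ha j), starPoly_eval _ _ _ (ha j)]

lemma starDet_eq_zero_of_out_of_range {p m : ℕ} {b : Fin p → ℤ} {j : Fin p}
    (hj : b j < 0 ∨ (m : ℤ) + p - 1 < b j) : starDet p m b = 0 := by
  refine Matrix.det_eq_zero_of_row_eq_zero j fun i => ?_
  have := i.2
  rw [Matrix.of_apply]
  rcases hj with hj | hj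
  · exact intChoose_of_neg _ (by omega)
  · exact intChoose_of_lt _ (by omega)

lemma centralBinom_sq_mul_le (k : ℕ) : k.centralBinom ^ 2 * (2 * k + 1) ≤ 16 ^ k := by
  induction k with
  | zero => simp
  | succ k ih =>
    have h := Nat.succ_mul_centralBinom_succ k
    refine le_of_mul_le_mul_left ?_ (show 0 < (k + 1) ^ 2 by positivity)
    calc (k + 1) ^ 2 * ((k + 1).centralBinom ^ 2 * (2 * (k + 1) + 1))
        = ((k + 1) * (k + 1).centralBinom) ^ 2 * (2 * k + 3) := by ring
      _ = 4 * (2 * k + 1) * (2 * k + 3) * (k.centralBinom ^ 2 * (2 * k + 1)) := by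
        rw [h]; ring
      _ ≤ 4 * (2 * k + 1) * (2 * k + 3) * 16 ^ k := Nat.mul_le_mul_left _ ih
      _ ≤ 16 * (k + 1) ^ 2 * 16 ^ k := Nat.mul_le_mul_right _ (by nlinarith)
      _ = (k + 1) ^ 2 * 16 ^ (k + 1) := by ring

lemma le_centralBinom_sq_mul {k : ℕ} (hk : 1 ≤ k) : 16 ^ k ≤ k.centralBinom ^ 2 * (4 * k) := by
  induction k, hk using Nat.le_induction with
  | base => simp [Nat.centralBinom, Nat.choose]
  | succ k hk ih =>
    have h := Nat.succ_mul_centralBinom_succ k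
    refine le_of_mul_le_mul_left ?_ (show 0 < k * (k + 1) by positivity)
    calc k * (k + 1) * 16 ^ (k + 1) = 4 * (4 * k * (k + 1)) * 16 ^ k := by ring
      _ ≤ 4 * (2 * k + 1) ^ 2 * 16 ^ k := Nat.mul_le_mul_right _ (by nlinarith)
      _ ≤ 4 * (2 * k + 1) ^ 2 * (k.centralBinom ^ 2 * (4 * k)) := Nat.mul_le_mul_left _ ih
      _ = (2 * (2 * k + 1) * k.centralBinom) ^ 2 * (4 * k) := by ring
      _ = k * (k + 1) * ((k + 1).centralBinom ^ 2 * (4 * (k + 1))) := by rw [← h]; ring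

lemma choose_sq_mul_succ_le (N a : ℕ) : N.choose a ^ 2 * (N + 1) ≤ 4 ^ N := by
  have h := Nat.pow_le_pow_left (Nat.choose_le_middle a N) 2
  refine (Nat.mul_le_mul_right _ h).trans ?_
  rcases N.even_or_odd' with ⟨k, rfl | rfl⟩
  · have := centralBinom_sq_mul_le k
    rw [Nat.centralBinom] at this
    rw [Nat.mul_div_cancel_left _ two_pos, pow_mul]
    exact this
  · have h1 := centralBinom_sq_mul_le (k + 1)
    have h2 : (k + 1).centralBinom = 2 * (2 * k + 1).choose k := by
      rw [Nat.centralBinom, show 2 * (k + 1) = (2 * k + 1) + 1 by ring, Nat.choose_succ_succ,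
        Nat.choose_symm_half, two_mul ((2 * k + 1).choose k)]
    rw [show (2 * k + 1) / 2 = k by omega]
    rw [h2] at h1
    have h3 : (16 : ℕ) ^ (k + 1) = 4 * 4 ^ (2 * k + 1) := by
      rw [show (16 : ℕ) = 4 ^ 2 by norm_num, ← pow_mul]; ring
    rw [h3] at h1
    nlinarith [Nat.zero_le ((2 * k + 1).choose k ^ 2)]

lemma choose_mul_sqrt_le {m N a : ℕ} (hm : m ≤ N) :
    (N.choose a : ℝ) * √(m + 1) ≤ 2 ^ N := by
  refine (sq_le_sq₀ (by positivity) (by positivity)).1 ?_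
  rw [mul_pow, Real.sq_sqrt (by positivity), ← pow_mul, mul_comm N, pow_mul]
  have h : ((N.choose a : ℝ)) ^ 2 * (N + 1) ≤ 4 ^ N := by
    exact_mod_cast choose_sq_mul_succ_le N a
  have hm' : (m : ℝ) ≤ N := by exact_mod_cast hm
  norm_num
  refine le_trans ?_ h
  gcongr

lemma four_pow_le_centralBinom_mul_sqrt {n : ℕ} (hn : 1 ≤ n) :
    (4 : ℝ) ^ n ≤ n.centralBinom * (2 * √n) := by
  refine (sq_le_sq₀ (by positivity) (by positivity)).1 ?_
  rw [mul_pow, mul_pow, Real.sq_sqrt (by positivity), ← pow_mul, mul_comm n, pow_mul]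
  norm_num
  exact_mod_cast le_centralBinom_sq_mul hn

lemma prod_pow_odd (p : ℕ) (s : ℝ) :
    ∏ j : Fin p, s ^ (2 * (p - 1 - (j : ℕ)) + 1) = s ^ (p ^ 2) := by
  rw [Finset.prod_pow_eq_pow_sum]
  congr 1
  rw [Fin.sum_univ_eq_sum_range (fun j => 2 * (p - 1 - j) + 1),
    Finset.sum_range_reflect (fun j => 2 * j + 1)]
  induction p with
  | zero => rfl
  | succ p ih => rw [Finset.sum_range_succ, ih]; ring

lemma det_vandermonde_pos {p : ℕ} {b : Fin p → ℤ} (hb : StrictMono b) :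
    0 < (Matrix.vandermonde b).det := by
  rw [Matrix.det_vandermonde]
  exact Finset.prod_pos fun i _ => Finset.prod_pos fun j hj =>
    sub_pos.2 (hb (Finset.mem_Ioi.1 hj))

lemma factorial_add_mul_pow_le {p m a j : ℕ} (hj : j < p) (ha : a ≤ m + p - 1) :
    ((m + j).factorial : ℝ) * √(m + 1) ^ (2 * (p - 1 - j) + 1) ≤
      2 ^ (m + p - 1) * ((a.factorial * (m + p - 1 - a).factorial : ℕ) : ℝ) := by
  have h1 : (m + j).factorial * (m + 1) ^ (p - 1 - j) ≤ (m + p - 1).factorial := by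
    have := Nat.factorial_mul_pow_le_factorial (m := m + j) (n := p - 1 - j)
    rw [show m + j + (p - 1 - j) = m + p - 1 by omega] at this
    refine le_trans (Nat.mul_le_mul_left _ (Nat.pow_le_pow_left (by omega) _)) this
  have h2 := Nat.choose_mul_factorial_mul_factorial ha
  have h3 := choose_mul_sqrt_le (a := a) (show m ≤ m + p - 1 by omega)
  rw [pow_succ, pow_mul, Real.sq_sqrt (by positivity), ← mul_assoc]
  calc ((m + j).factorial : ℝ) * ((m : ℝ) + 1) ^ (p - 1 - j) * √(m + 1)
      ≤ ((m + p - 1).factorial : ℝ) * √(m + 1) := by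
        gcongr
        exact_mod_cast h1
    _ = ((m + p - 1).choose a : ℝ) * √(m + 1) *
        ((a.factorial * (m + p - 1 - a).factorial : ℕ) : ℝ) := by
        rw [← h2]; push_cast; ring
    _ ≤ _ := by gcongr

lemma starDet_mul_sqrt_pow_le {p m : ℕ} {b : Fin p → ℤ} (hb : StrictMono b) :
    (starDet p m b : ℝ) * √(m + 1) ^ (p ^ 2) ≤
      (2 ^ (m + p - 1)) ^ p * ((Matrix.vandermonde b).det : ℝ) := by
  have hV : (0 : ℝ) < ((Matrix.vandermonde b).det : ℝ) := by
    exact_mod_cast det_vandermonde_pos hb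
  by_cases h : ∃ j, b j < 0 ∨ (m : ℤ) + p - 1 < b j
  · obtain ⟨j, hj⟩ := h
    rw [starDet_eq_zero_of_out_of_range hj, Int.cast_zero, zero_mul]
    positivity
  push Not at h
  have hb0 : ∃ a : Fin p → ℕ, b = fun j => (a j : ℤ) :=
    ⟨fun j => (b j).toNat, by ext j; exact (Int.toNat_of_nonneg (h j).1).symm⟩
  obtain ⟨a, rfl⟩ := hb0
  have ha : ∀ j, a j ≤ m + p - 1 := fun j => by
    have h1 : (a j : ℤ) ≤ m + p - 1 := (h j).2
    have := j.2
    omega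
  have key := starDet_mul_prod_factorial p m a ha
  have keyR : (∏ j, (((a j).factorial * (m + p - 1 - a j).factorial : ℕ) : ℝ)) *
        (starDet p m (fun j => (a j : ℤ)) : ℝ) =
      (∏ j : Fin p, ((m + j).factorial : ℝ)) *
        ((Matrix.vandermonde fun j => (a j : ℤ)).det : ℝ) := by exact_mod_cast key
  have hprod := Finset.prod_le_prod (s := Finset.univ)
    (fun (j : Fin p) _ => by positivity) (fun j _ => factorial_add_mul_pow_le j.2 (ha j))
  rw [Finset.prod_mul_distrib, Finset.prod_mul_distrib, prod_pow_odd, Fin.prod_const] at hprod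
  have hF : 0 < ∏ j, (((a j).factorial * (m + p - 1 - a j).factorial : ℕ) : ℝ) :=
    Finset.prod_pos fun j _ => by positivity
  refine le_of_mul_le_mul_left ?_ hF
  rw [← mul_assoc, keyR]
  nlinarith [mul_le_mul_of_nonneg_right hprod hV.le]

lemma factorial_add_le_mul_pow {p n k : ℕ} (hn : 1 ≤ n) (hk : k ≤ p) :
    (n + k).factorial ≤ n.factorial * ((p + 1) * n) ^ k := by
  induction k with
  | zero => simp
  | succ k ih =>
    rw [← add_assoc, Nat.factorial_succ, pow_succ, ← mul_assoc, mul_comm]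
    refine Nat.mul_le_mul (ih (by omega)) ?_
    nlinarith

lemma four_pow_mul_factorial_le {p n j : ℕ} (hn : 1 ≤ n) (hj : j < p) :
    (4 : ℝ) ^ n * (((n + j).factorial * (2 * n + p - 1 - (n + j)).factorial : ℕ) : ℝ) ≤
      2 * ((p : ℝ) + 1) ^ (p - 1) * (√n ^ (2 * (p - 1 - j) + 1) * ((2 * n + j).factorial : ℝ)) := by
  obtain ⟨e, rfl⟩ : ∃ e, p = j + e + 1 := ⟨p - j - 1, by omega⟩
  rw [show 2 * n + (j + e + 1) - 1 - (n + j) = n + e by omega,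
    show j + e + 1 - 1 - j = e by omega, show j + e + 1 - 1 = j + e by omega]
  have h1 := factorial_add_le_mul_pow (p := j + e + 1) hn (show j ≤ _ by omega)
  have h2 := factorial_add_le_mul_pow (p := j + e + 1) hn (show e ≤ _ by omega)
  have h3 : (2 * n).factorial * n ^ j ≤ (2 * n + j).factorial :=
    le_trans (Nat.mul_le_mul_left _ (Nat.pow_le_pow_left (by omega) _))
      Nat.factorial_mul_pow_le_factorial
  have h4 : n.centralBinom * (n.factorial * n.factorial) = (2 * n).factorial := by
    have := Nat.choose_mul_factorial_mul_factorial (show n ≤ 2 * n by omega)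
    rw [show 2 * n - n = n by omega] at this
    rw [Nat.centralBinom, ← this, mul_assoc]
  have h5 := four_pow_le_centralBinom_mul_sqrt hn
  have h12 := Nat.mul_le_mul h1 h2
  rw [pow_succ, pow_mul, Real.sq_sqrt (by positivity)]
  calc (4 : ℝ) ^ n * (((n + j).factorial * (n + e).factorial : ℕ) : ℝ)
      ≤ (n.centralBinom * (2 * √n)) * ((n.factorial * ((j + e + 1 + 1) * n) ^ j *
          (n.factorial * ((j + e + 1 + 1) * n) ^ e) : ℕ) : ℝ) := by
        gcongr
    _ = 2 * (((j + e + 1 : ℕ) : ℝ) + 1) ^ (j + e) * ((n : ℝ) ^ e * √n *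
          (((n.centralBinom * (n.factorial * n.factorial)) * n ^ j : ℕ) : ℝ)) := by
        push_cast
        rw [mul_pow, mul_pow, pow_add]
        ring
    _ ≤ _ := by
        rw [h4]
        gcongr

lemma four_pow_le_starDet_mul {p n : ℕ} (hn : 1 ≤ n) :
    ((4 : ℝ) ^ n) ^ p ≤ (2 * ((p : ℝ) + 1) ^ (p - 1)) ^ p *
      (√n ^ (p ^ 2) * (starDet p (2 * n) (fun j => ((n + j : ℕ) : ℤ)) : ℝ)) := by
  have ha : ∀ j : Fin p, n + (j : ℕ) ≤ 2 * n + p - 1 := fun j => by omega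
  have key := starDet_mul_prod_factorial p (2 * n) (fun j => n + (j : ℕ)) ha
  have hb : StrictMono (fun j : Fin p => ((n + j : ℕ) : ℤ)) := fun i j hij => by
    have : (i : ℕ) < j := hij
    simp only
    omega
  have hV : (1 : ℝ) ≤ ((Matrix.vandermonde fun j : Fin p => ((n + j : ℕ) : ℤ)).det : ℝ) := by
    exact_mod_cast det_vandermonde_pos hb
  have keyR : (∏ j : Fin p,
        (((n + (j : ℕ)).factorial * (2 * n + p - 1 - (n + (j : ℕ))).factorial : ℕ) : ℝ)) *
        (starDet p (2 * n) (fun j => ((n + j : ℕ) : ℤ)) : ℝ) =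
      (∏ j : Fin p, ((2 * n + j).factorial : ℝ)) *
        ((Matrix.vandermonde fun j : Fin p => ((n + j : ℕ) : ℤ)).det : ℝ) := by
    exact_mod_cast key
  have hprod := Finset.prod_le_prod (s := Finset.univ)
    (fun (j : Fin p) _ => by positivity) (fun j _ => four_pow_mul_factorial_le hn j.2)
  rw [Finset.prod_mul_distrib, Fin.prod_const, Finset.prod_mul_distrib, Fin.prod_const,
    Finset.prod_mul_distrib, prod_pow_odd] at hprod
  have hF : 0 < ∏ j : Fin p,
      (((n + (j : ℕ)).factorial * (2 * n + p - 1 - (n + (j : ℕ))).factorial : ℕ) : ℝ) :=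
    Finset.prod_pos fun j _ => by positivity
  refine le_of_mul_le_mul_left ?_ hF
  rw [mul_comm _ (((4 : ℝ) ^ n) ^ p)]
  refine hprod.trans ?_
  rw [mul_left_comm (Finset.prod _ _), mul_left_comm (Finset.prod _ _), keyR]
  gcongr
  exact le_mul_of_one_le_right (Finset.prod_nonneg fun _ _ => by positivity) hV

lemma isMelonNW_iff {p n : ℕ} {w : Fin p → ℕ → ℤ} :
    IsMelonNW p n w ↔ w ∈ starSet p (2 * n) (fun j => ((n + j : ℕ) : ℤ)) := by
  refine and_congr_right fun _ => forall_congr' fun i => ?_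
  push_cast
  constructor <;> intro h <;> linarith

lemma strictMono_add_index (p n : ℕ) : StrictMono (fun j : Fin p => ((n + j : ℕ) : ℤ)) :=
  fun i j hij => by
    have : (i : ℕ) < j := hij
    simp only
    omega

lemma setOf_isMelonNW_finite (p n : ℕ) : {w : Fin p → ℕ → ℤ | IsMelonNW p n w}.Finite := by
  refine (starSet_finite_and_ncard p (2 * n) _ (strictMono_add_index p n).monotone).1.subset ?_
  exact fun w hw => isMelonNW_iff.1 hw

lemma exists_eq_two_mul_sub {p m : ℕ} {w : Fin p → ℕ → ℤ} (hw : IsStarNW p m w) (i : Fin p) {k : ℕ}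
    (hk : k ≤ m) : ∃ b : ℤ, w i k = 2 * b - k := by
  induction k with
  | zero => exact ⟨i, by simp [hw.1 i]⟩
  | succ k ih =>
    obtain ⟨b, hb⟩ := ih (by omega)
    rcases hw.2.1 i k (by omega) with h | h
    · exact ⟨b + 1, by push_cast; omega⟩
    · exact ⟨b, by push_cast; omega⟩

lemma exists_strictMono_eq_two_mul_sub {p m k : ℕ} {w : Fin p → ℕ → ℤ} (hw : IsStarNW p m w)
    (hk : k ≤ m) : ∃ b : Fin p → ℤ, StrictMono b ∧ ∀ i, w i k = 2 * b i - k := by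
  choose b hb using fun i => exists_eq_two_mul_sub hw i hk
  refine ⟨b, fun i j hij => ?_, hb⟩
  have := hw.2.2.1 i j hij k hk
  rw [hb i, hb j] at this
  omega

lemma initial_mem_starSet {p n m : ℕ} {b : Fin p → ℤ} {w : Fin p → ℕ → ℤ} (hm : m ≤ 2 * n)
    (hw : IsMelonNW p n w) (hb : ∀ i, w i m = 2 * b i - m) :
    (fun i k => if k ≤ m then w i k else 0) ∈ starSet p m b := by
  obtain ⟨⟨h0, h1, h2, -⟩, -⟩ := hw
  refine ⟨⟨?_, ?_, ?_, ?_⟩, ?_⟩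
  · simpa using h0
  · intro i k hk
    simp only
    rw [if_pos (by omega), if_pos (by omega)]
    exact h1 i k (by omega)
  · intro i j hij k hk
    simp only
    rw [if_pos hk, if_pos hk]
    exact h2 i j hij k (by omega)
  · intro i k hk
    simp only
    rw [if_neg (by omega)]
  · simpa using hb

lemma reversed_mem_starSet {p n m : ℕ} {b : Fin p → ℤ} {w : Fin p → ℕ → ℤ} (hm : m ≤ 2 * n)
    (hw : IsMelonNW p n w) (hb : ∀ i, w i m = 2 * b i - m) :
    (fun i k => if k ≤ 2 * n - m then w i (2 * n - k) else 0) ∈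
      starSet p (2 * n - m) (fun i => b i + ((n : ℤ) - m)) := by
  obtain ⟨⟨-, h1, h2, -⟩, h4⟩ := hw
  refine ⟨⟨?_, ?_, ?_, ?_⟩, ?_⟩
  · simpa using h4
  · intro i k hk
    simp only
    rw [if_pos (by omega), if_pos (by omega)]
    have := h1 i (2 * n - (k + 1)) (by omega)
    rw [show 2 * n - (k + 1) + 1 = 2 * n - k by omega] at this
    omega
  · intro i j hij k hk
    simp only
    rw [if_pos hk, if_pos hk]
    exact h2 i j hij _ (by omega)
  · intro i k hk
    simp only
    rw [if_neg (by omega)]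
  · intro i
    simp only
    rw [if_pos le_rfl, show 2 * n - (2 * n - m) = m by omega, hb i, Nat.cast_sub hm]
    push_cast
    ring

lemma ncard_melon_through_le {p n m : ℕ} {b : Fin p → ℤ} (hb : StrictMono b) (hm : m ≤ 2 * n) :
    (({w : Fin p → ℕ → ℤ | IsMelonNW p n w ∧ ∀ i, w i m = 2 * b i - m}.ncard : ℤ)) ≤
      starDet p m b * starDet p (2 * n - m) (fun i => b i + ((n : ℤ) - m)) := by
  have hb' : Monotone fun i => b i + ((n : ℤ) - m) := hb.monotone.add_const _
  obtain ⟨f1, e1⟩ := starSet_finite_and_ncard p m b hb.monotone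
  obtain ⟨f2, e2⟩ := starSet_finite_and_ncard p (2 * n - m) _ hb'
  rw [← e1, ← e2, ← Nat.cast_mul, ← Set.ncard_prod, Nat.cast_le]
  refine Set.ncard_le_ncard_of_injOn
    (fun w => (fun i k => if k ≤ m then w i k else 0,
      fun i k => if k ≤ 2 * n - m then w i (2 * n - k) else 0))
    (fun w hw => ⟨initial_mem_starSet hm hw.1 hw.2, reversed_mem_starSet hm hw.1 hw.2⟩) ?_
    (f1.prod f2)
  intro v hv w hw hvw
  obtain ⟨hvw1, hvw2⟩ := Prod.mk.inj hvw
  ext i k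
  rcases le_or_gt k m with hk | hk
  · simpa [hk] using congrFun (congrFun hvw1 i) k
  rcases le_or_gt k (2 * n) with hk' | hk'
  · have := congrFun (congrFun hvw2 i) (2 * n - k)
    rwa [if_pos (by omega), if_pos (by omega), show 2 * n - (2 * n - k) = k by omega] at this
  · rw [hv.1.1.2.2.2 i k hk', hw.1.1.2.2.2 i k hk']

lemma starDet_nonneg {p m : ℕ} {b : Fin p → ℤ} (hb : Monotone b) : 0 ≤ starDet p m b := by
  rw [← (starSet_finite_and_ncard p m b hb).2]
  positivity

/-- The constant in `ncard_melon_through_mul_le`. -/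
noncomputable def throughConst (p : ℕ) : ℝ :=
  (4 ^ (p - 1)) ^ p * (2 * ((p : ℝ) + 1) ^ (p - 1)) ^ p

lemma ncard_melon_through_mul_le {p n m : ℕ} (hp : 1 ≤ p) {ε : ℝ} (hε : 0 < ε) (hn : 1 ≤ n)
    {b : Fin p → ℤ}
    (hb : StrictMono b) (hm : m ≤ 2 * n) (h1 : 2 * n * ε ≤ m + 1)
    (h2 : 2 * n * ε ≤ (2 * n - m : ℕ) + 1) :
    ({w : Fin p → ℕ → ℤ | IsMelonNW p n w ∧ ∀ i, w i m = 2 * b i - m}.ncard : ℝ) *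
        ((2 * ε) ^ (p ^ 2) * √n ^ (p ^ 2)) ≤
      throughConst p * ({w : Fin p → ℕ → ℤ | IsMelonNW p n w}.ncard : ℝ) *
        ((Matrix.vandermonde b).det : ℝ) ^ 2 := by
  set m' := 2 * n - m with hm'
  set b' : Fin p → ℤ := fun i => b i + ((n : ℤ) - m) with hb'
  have hb's : StrictMono b' := hb.add_const _
  have hs : (0 : ℝ) < √n := Real.sqrt_pos.2 (by exact_mod_cast hn)
  have hF : ({w : Fin p → ℕ → ℤ | IsMelonNW p n w ∧ ∀ i, w i m = 2 * b i - m}.ncard : ℝ) ≤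
      (starDet p m b : ℝ) * (starDet p m' b' : ℝ) := by
    have h := (Int.cast_le (R := ℝ)).2 (ncard_melon_through_le hb hm)
    rwa [Int.cast_mul, Int.cast_natCast] at h
  have hN : (({w : Fin p → ℕ → ℤ | IsMelonNW p n w}.ncard : ℝ)) =
      (starDet p (2 * n) (fun j => ((n + j : ℕ) : ℤ)) : ℝ) := by
    have := (starSet_finite_and_ncard p (2 * n) _ (strictMono_add_index p n).monotone).2
    have h : {w : Fin p → ℕ → ℤ | IsMelonNW p n w} =
      starSet p (2 * n) (fun j => ((n + j : ℕ) : ℤ)) := Set.ext fun w => isMelonNW_iff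
    rw [h]
    exact_mod_cast this
  have hV : (Matrix.vandermonde b').det = (Matrix.vandermonde b).det :=
    Matrix.det_vandermonde_add b _
  have u1 := starDet_mul_sqrt_pow_le (m := m) hb
  have u2 := starDet_mul_sqrt_pow_le (m := m') hb's
  have l := four_pow_le_starDet_mul (p := p) hn
  rw [hV] at u2
  rw [← hN] at l
  have d1 : (0 : ℝ) ≤ starDet p m b := by exact_mod_cast starDet_nonneg hb.monotone
  have d2 : (0 : ℝ) ≤ starDet p m' b' := by exact_mod_cast starDet_nonneg hb's.monotone
  have hVp : (0 : ℝ) < ((Matrix.vandermonde b).det : ℝ) := by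
    exact_mod_cast det_vandermonde_pos hb
  have hsq : √n * √n * (2 * ε) ≤ √((m : ℝ) + 1) * √((m' : ℝ) + 1) := by
    rw [Real.mul_self_sqrt (by positivity), ← Real.sqrt_mul (by positivity)]
    refine Real.le_sqrt_of_sq_le ?_
    rw [sq]
    refine mul_le_mul ?_ ?_ (by positivity) (by positivity) <;> linarith
  have hpow : ((2 : ℝ) ^ (m + p - 1)) ^ p * (2 ^ (m' + p - 1)) ^ p =
      (4 ^ (p - 1)) ^ p * ((4 : ℝ) ^ n) ^ p := by
    rw [← mul_pow, ← mul_pow]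
    congr 1
    rw [← pow_add, ← pow_add, show (4 : ℝ) = 2 ^ 2 by norm_num, ← pow_mul]
    congr 1
    omega
  refine le_of_mul_le_mul_right ?_ (show 0 < √n ^ (p ^ 2) by positivity)
  calc _ ≤ ((starDet p m b : ℝ) * (starDet p m' b' : ℝ)) * ((2 * ε) ^ (p ^ 2) * √n ^ (p ^ 2)) *
          √n ^ (p ^ 2) := by gcongr
    _ = ((starDet p m b : ℝ) * (starDet p m' b' : ℝ)) * (√n * √n * (2 * ε)) ^ (p ^ 2) := by
        rw [mul_pow, mul_pow]; ring
    _ ≤ ((starDet p m b : ℝ) * (starDet p m' b' : ℝ)) *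
          (√((m : ℝ) + 1) * √((m' : ℝ) + 1)) ^ (p ^ 2) := by gcongr
    _ = ((starDet p m b : ℝ) * √((m : ℝ) + 1) ^ (p ^ 2)) *
          ((starDet p m' b' : ℝ) * √((m' : ℝ) + 1) ^ (p ^ 2)) := by rw [mul_pow]; ring
    _ ≤ ((2 ^ (m + p - 1)) ^ p * ((Matrix.vandermonde b).det : ℝ)) *
          ((2 ^ (m' + p - 1)) ^ p * ((Matrix.vandermonde b).det : ℝ)) := by
        gcongr
    _ = (((2 : ℝ) ^ (m + p - 1)) ^ p * (2 ^ (m' + p - 1)) ^ p) *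
          ((Matrix.vandermonde b).det : ℝ) ^ 2 := by ring
    _ ≤ (4 ^ (p - 1)) ^ p * ((2 * ((p : ℝ) + 1) ^ (p - 1)) ^ p *
          (√n ^ (p ^ 2) * ({w : Fin p → ℕ → ℤ | IsMelonNW p n w}.ncard : ℝ))) *
          ((Matrix.vandermonde b).det : ℝ) ^ 2 := by
        rw [hpow]
        gcongr
    _ = _ := by rw [throughConst]; ring

lemma sum_card_Ioi_mul_two (p : ℕ) :
    (∑ i : Fin p, (Finset.Ioi i).card) * 2 = p * (p - 1) := by
  simp_rw [Fin.card_Ioi]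
  rw [Fin.sum_univ_eq_sum_range (fun i => p - 1 - i), Finset.sum_range_reflect (fun i => i),
    Finset.sum_range_id_mul_two]

lemma det_vandermonde_sq_le {p : ℕ} {b : Fin p → ℤ} (hb : StrictMono b) {i₀ j₀ : Fin p}
    (hij : i₀ < j₀) {G L : ℝ} (hL : 0 < L) (hG : (b j₀ : ℝ) - b i₀ ≤ G)
    (hb' : ∀ i j, (b j : ℝ) - b i ≤ L) :
    ((Matrix.vandermonde b).det : ℝ) ^ 2 ≤ (G / L) ^ 2 * L ^ (p * (p - 1)) := by
  have hpos : ∀ i j, i < j → (0 : ℝ) < (b j : ℝ) - b i := fun i j h =>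
    sub_pos.2 (by exact_mod_cast hb h)
  have h : ((Matrix.vandermonde b).det : ℝ) ≤
      ∏ i : Fin p, ∏ j ∈ Finset.Ioi i, L * (if j = j₀ then if i = i₀ then G / L else 1 else 1) := by
    rw [Matrix.det_vandermonde]
    push_cast
    refine Finset.prod_le_prod (fun i _ => Finset.prod_nonneg fun j hj =>
      (hpos i j (Finset.mem_Ioi.1 hj)).le) fun i _ => Finset.prod_le_prod (fun j hj =>
      (hpos i j (Finset.mem_Ioi.1 hj)).le) fun j _ => ?_
    split_ifs with h1 h2
    · subst h1 h2
      rw [mul_div_cancel₀ _ hL.ne']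
      exact hG
    · simpa using hb' i j
    · simpa using hb' i j
  have h' : ∏ i : Fin p, ∏ j ∈ Finset.Ioi i,
      L * (if j = j₀ then if i = i₀ then G / L else 1 else 1) =
      G / L * L ^ (∑ i : Fin p, (Finset.Ioi i).card) := by
    simp_rw [Finset.prod_mul_distrib, Finset.prod_const]
    rw [Finset.prod_pow_eq_pow_sum, mul_comm]
    congr 1
    simp_rw [Finset.prod_ite_eq', Finset.mem_Ioi]
    rw [Finset.prod_eq_single i₀]
    · simp [hij]
    · intro i _ hi
      simp [hi]
    · simp
  rw [h'] at h
  have hV : (0 : ℝ) < ((Matrix.vandermonde b).det : ℝ) := by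
    exact_mod_cast det_vandermonde_pos hb
  refine (pow_le_pow_left₀ hV.le h 2).trans_eq ?_
  rw [mul_pow, ← pow_mul, sum_card_Ioi_mul_two]

/-- The endpoints with a small gap between two given branches lie in a small finite set. -/
lemma exists_endpoint_finset {p : ℕ} {i₀ j₀ : Fin p} (hij : i₀ < j₀) (m : ℕ) {R G L : ℝ}
    (hR : 0 ≤ R) (hRL : R + 1 ≤ L) (hG : 0 ≤ G) :
    ∃ B : Finset (Fin p → ℤ), (B.card : ℝ) ≤ G / L * L ^ p ∧
      ∀ b : Fin p → ℤ, StrictMono b → (b j₀ : ℝ) - b i₀ ≤ G →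
        (∀ i, |2 * (b i : ℝ) - m| ≤ R) → b ∈ B := by
  classical
  have hL : 0 < L := by linarith
  set J : Finset ℤ := Finset.Icc ⌈((m : ℝ) - R) / 2⌉ ⌊((m : ℝ) + R) / 2⌋ with hJ
  have hJc : (J.card : ℝ) ≤ L := by
    rw [hJ, Int.card_Icc, ← Int.cast_natCast, Int.toNat_eq_max, Int.cast_max]
    refine max_le ?_ (by simpa using hL.le)
    push_cast
    have h1 := Int.floor_le (((m : ℝ) + R) / 2)
    have h2 := Int.le_ceil (((m : ℝ) - R) / 2)
    linarith
  have hGc : ((Finset.Icc (1 : ℤ) ⌊G⌋).card : ℝ) ≤ G := by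
    rw [Int.card_Icc, ← Int.cast_natCast, Int.toNat_eq_max, Int.cast_max]
    refine max_le ?_ (by simpa using hG)
    push_cast
    have h1 := Int.floor_le G
    linarith
  refine ⟨(Fintype.piFinset fun i => if i = j₀ then Finset.Icc (1 : ℤ) ⌊G⌋ else J).image
    fun u => Function.update u j₀ (u i₀ + u j₀), ?_, ?_⟩
  · refine (Nat.cast_le.2 Finset.card_image_le).trans ?_
    rw [Fintype.card_piFinset, Nat.cast_prod]
    calc _ ≤ ∏ i : Fin p, (if i = j₀ then G / L else 1) * L := by
          refine Finset.prod_le_prod (fun i _ => by positivity) fun i _ => ?_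
          split_ifs
          · rwa [div_mul_cancel₀ _ hL.ne']
          · rwa [one_mul]
      _ = G / L * L ^ p := by
          rw [Finset.prod_mul_distrib, Fin.prod_const]
          simp
  · intro b hb hbG hbR
    refine Finset.mem_image.2 ⟨Function.update b j₀ (b j₀ - b i₀), ?_, ?_⟩
    · rw [Fintype.mem_piFinset]
      intro i
      by_cases hi : i = j₀
      · subst hi
        simp only [Function.update_self, if_true, Finset.mem_Icc, Int.le_floor]
        refine ⟨by have := hb hij; omega, by push_cast; exact hbG⟩
      · rw [if_neg hi, Function.update_of_ne hi, hJ, Finset.mem_Icc, Int.ceil_le, Int.le_floor]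
        have := abs_le.1 (hbR i)
        constructor <;> linarith
    · ext i
      by_cases hi : i = j₀
      · subst hi
        simp [Function.update_of_ne hij.ne]
      · simp [Function.update_of_ne hi]

lemma probNW_eq (p n : ℕ) (E : (Fin p → ℕ → ℤ) → Prop) :
    probNW p n E = ({w | IsMelonNW p n w ∧ E w}.ncard : ℝ) / ({w | IsMelonNW p n w}.ncard : ℝ) :=
  rfl

/-- A bound for the probability that two given branches of a watermelon are close and all branches
are bounded at a given time. -/
lemma probNW_close_le {p n m : ℕ} {i₀ j₀ : Fin p} (hij : i₀ < j₀) {ε r D : ℝ}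
    (hε : 0 < ε) (hr : 0 < r) (hD : 0 ≤ D) (hn : 1 ≤ n) (hm : m ≤ 2 * n)
    (h1 : 2 * n * ε ≤ m + 1) (h2 : 2 * n * ε ≤ (2 * n - m : ℕ) + 1) :
    probNW p n (fun w => (w j₀ m : ℝ) - (w i₀ m : ℝ) ≤ D ∧
        ∀ i, |(w i m : ℝ)| ≤ r * √(2 * n)) ≤
      throughConst p * ((r * √2 + 1) / (2 * ε)) ^ (p ^ 2) * (D / √n) ^ 3 := by
  classical
  have hp : 1 ≤ p := by have := i₀.2; omega
  set s : ℝ := √n with hs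
  have hs1 : 1 ≤ s := Real.one_le_sqrt.2 (by exact_mod_cast hn)
  set K : ℝ := r * √2 + 1 with hK
  have hK1 : 1 ≤ K := by rw [hK]; linarith [mul_nonneg hr.le (Real.sqrt_nonneg 2)]
  set L : ℝ := K * s with hL
  have hLs : s ≤ L := le_mul_of_one_le_left (by positivity) hK1
  have hLpos : 0 < L := by linarith
  set R : ℝ := r * √(2 * n) with hR
  have hRnn : 0 ≤ R := by positivity
  have hRL : R + 1 ≤ L := by
    rw [hR, hL, hK, Real.sqrt_mul (by norm_num), ← hs]
    linarith
  set N : ℝ := ({w : Fin p → ℕ → ℤ | IsMelonNW p n w}.ncard : ℝ) with hN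
  have hNnn : 0 ≤ N := by positivity
  obtain ⟨B, hBc, hB⟩ := exists_endpoint_finset hij m hRnn hRL (show 0 ≤ D / 2 by positivity)
  set Q : (Fin p → ℤ) → Prop := fun b => StrictMono b ∧ (b j₀ : ℝ) - b i₀ ≤ D / 2 ∧
    ∀ i, |2 * (b i : ℝ) - m| ≤ R
  set F : (Fin p → ℤ) → Set (Fin p → ℕ → ℤ) := fun b =>
    {w : Fin p → ℕ → ℤ | IsMelonNW p n w ∧ ∀ i, w i m = 2 * b i - m}
  set M : ℝ := throughConst p * N * ((D / 2 / L) ^ 2 * L ^ (p * (p - 1))) /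
    ((2 * ε) ^ (p ^ 2) * s ^ (p ^ 2)) with hM
  have hc : 0 ≤ throughConst p := by rw [throughConst]; positivity
  have hFM : ∀ b ∈ B.filter Q, ((F b).ncard : ℝ) ≤ M := by
    intro b hbB
    obtain ⟨hb, hbD, hbR⟩ := (Finset.mem_filter.1 hbB).2
    rw [hM, le_div_iff₀ (by positivity)]
    refine (ncard_melon_through_mul_le hp hε hn hb hm h1 h2).trans ?_
    gcongr
    refine det_vandermonde_sq_le hb hij hLpos hbD fun i j => ?_
    have a1 := abs_le.1 (hbR i)
    have a2 := abs_le.1 (hbR j)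
    linarith
  have hsub : {w : Fin p → ℕ → ℤ | IsMelonNW p n w ∧ ((w j₀ m : ℝ) - (w i₀ m : ℝ) ≤ D ∧
        ∀ i, |(w i m : ℝ)| ≤ R)} ⊆ ⋃ b ∈ B.filter Q, F b := by
    rintro w ⟨hw, hwD, hwR⟩
    obtain ⟨b, hb, hbw⟩ := exists_strictMono_eq_two_mul_sub hw.1 hm
    have hbw' : ∀ i, (w i m : ℝ) = 2 * b i - m := fun i => by rw [hbw i]; push_cast; ring
    have q1 : (b j₀ : ℝ) - b i₀ ≤ D / 2 := by
      rw [hbw', hbw'] at hwD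
      linarith
    have q2 : ∀ i, |2 * (b i : ℝ) - m| ≤ R := fun i => by
      rw [← hbw' i]
      exact hwR i
    simp only [Set.mem_iUnion]
    exact ⟨b, Finset.mem_filter.2 ⟨hB b hb q1 q2, hb, q1, q2⟩, hw, hbw⟩
  have hfin : (⋃ b ∈ B.filter Q, F b).Finite :=
    (setOf_isMelonNW_finite p n).subset (Set.iUnion₂_subset fun b _ w hw => hw.1)
  have hMnn : 0 ≤ M := by rw [hM]; positivity
  have hcount : ({w : Fin p → ℕ → ℤ | IsMelonNW p n w ∧ ((w j₀ m : ℝ) - (w i₀ m : ℝ) ≤ D ∧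
        ∀ i, |(w i m : ℝ)| ≤ R)}.ncard : ℝ) ≤ D / 2 / L * L ^ p * M := by
    calc _ ≤ ((∑ b ∈ B.filter Q, (F b).ncard : ℕ) : ℝ) :=
          Nat.cast_le.2 ((Set.ncard_le_ncard hsub hfin).trans
            (Finset.set_ncard_biUnion_le _ _))
      _ ≤ (B.filter Q).card * M := by
          rw [Nat.cast_sum, ← nsmul_eq_mul]
          exact Finset.sum_le_card_nsmul _ _ _ hFM
      _ ≤ B.card * M := by
          gcongr
          exact Finset.filter_subset _ _
      _ ≤ _ := by gcongr
  rw [probNW_eq]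
  refine div_le_of_le_mul₀ hNnn (by positivity) (hcount.trans ?_)
  have hpp : p * (p - 1) + p = p ^ 2 := by
    obtain ⟨q, rfl⟩ := Nat.exists_eq_add_of_le hp
    rw [Nat.add_sub_cancel_left]
    ring
  calc D / 2 / L * L ^ p * M
      = throughConst p * N * (D / 2 / L) ^ 3 * (L ^ (p * (p - 1) + p)) /
          ((2 * ε) ^ (p ^ 2) * s ^ (p ^ 2)) := by rw [hM, pow_add]; ring
    _ = throughConst p * N * (D / 2 / L) ^ 3 * (K / (2 * ε)) ^ (p ^ 2) := by
        rw [hpp, hL, mul_pow K s, div_pow K, mul_div_assoc]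
        congr 1
        field_simp
    _ ≤ throughConst p * N * (D / s) ^ 3 * (K / (2 * ε)) ^ (p ^ 2) := by
        gcongr
        linarith
    _ = _ := by ring

/-- the probability that two consecutive branches of a watermelon
without wall condition are within `n^α` of each other while all branches are
bounded by `r·√(2n)` in absolute value at time `⌊2nt⌋` is `O(n^{3(α−1/2)})`,
uniformly in `t ∈ [ε, 1−ε]`. Branches are 1-indexed in the paper: `Ŵ_j` is
branch number `j`, i.e. index `j−1` here. -/
theorem melonNW_close_branches_small_prob (p : ℕ) (hp : 2 ≤ p)
    (j : ℕ) (hj1 : 1 ≤ j) (hj2 : j ≤ p - 1)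
    (ε : ℝ) (hε0 : 0 < ε) (hε : ε < 1 / 2) (r : ℝ) (hr : 0 < r)
    (α : ℝ) (hα0 : 0 < α) (hα : α < 1 / 4) :
    ∃ c > (0 : ℝ), ∀ n : ℕ, 1 ≤ n → ∀ t : ℝ, ε ≤ t → t ≤ 1 - ε →
      probNW p n (fun w =>
          (w ⟨j, by omega⟩ ⌊2 * (n : ℝ) * t⌋₊ : ℝ)
              - (w ⟨j - 1, by omega⟩ ⌊2 * (n : ℝ) * t⌋₊ : ℝ) ≤ (n : ℝ) ^ α ∧
          ∀ i : Fin p, |(w i ⌊2 * (n : ℝ) * t⌋₊ : ℝ)| ≤ r * Real.sqrt (2 * n))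
        ≤ c * (n : ℝ) ^ (3 * (α - 1 / 2)) := by
  have hK : 0 < (r * √2 + 1) / (2 * ε) := by positivity
  have hc : 0 < throughConst p * ((r * √2 + 1) / (2 * ε)) ^ (p ^ 2) := by
    rw [throughConst]
    positivity
  refine ⟨_, hc, fun n hn t ht0 ht1 => ?_⟩
  have hn1 : (1 : ℝ) ≤ n := by exact_mod_cast hn
  have hnpos : (0 : ℝ) < n := by linarith
  have ht : 0 ≤ 2 * (n : ℝ) * t := by
    have : 0 ≤ t := by linarith
    positivity
  set m := ⌊2 * (n : ℝ) * t⌋₊ with hm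
  have hm1 : 2 * (n : ℝ) * t < m + 1 := Nat.lt_floor_add_one _
  have hm2 : (m : ℝ) ≤ 2 * n * t := Nat.floor_le ht
  have hmn : m ≤ 2 * n := by
    have : (m : ℝ) ≤ ((2 * n : ℕ) : ℝ) := by
      push_cast
      nlinarith
    exact_mod_cast this
  have hpow : ((n : ℝ) ^ α / √n) ^ 3 = (n : ℝ) ^ (3 * (α - 1 / 2)) := by
    rw [Real.sqrt_eq_rpow, ← Real.rpow_sub hnpos, ← Real.rpow_natCast, ← Real.rpow_mul hnpos.le]
    congr 1
    push_cast
    ring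
  rw [← hpow]
  refine probNW_close_le (i₀ := ⟨j - 1, by omega⟩) (j₀ := ⟨j, by omega⟩) ?_ hε0 hr (by positivity)
    hn hmn ?_ ?_
  · exact Fin.mk_lt_mk.2 (by omega)
  · nlinarith
  · rw [Nat.cast_sub hmn]
    push_cast
    nlinarith
end

section
/- For every integer k ≥ 1: (i) ∫∫_{0 ≤ u_1 ≤ u_2 < ∞} u_1^{2k−1} · (u_2² − u_1²)² · u_1² u_2² · exp(−(u_1² + u_2²)/2) du_1 du_2 = √π · [ (2k+2)! (14 − 4k) / ( 2^{2k+3} (k+1)! ) + (4k² + 11) · 2^{k−1} · k! · ( √2 − ∑_{j=0}^{k} C(2j, j)/2^{3j} ) ], and (ii) ∫∫_{0 ≤ u_1 ≤ u_2 < ∞} u_2^{2k−1} · (u_2² − u_1²)² · u_1² u_2² · exp(−(u_1² + u_2²)/2) du_1 du_2 = √π · [ −(2k+2)! (14 − 4k) / ( 2^{2k+3} (k+1)! ) + (4k² + 11) · 2^{k−1} · k! · ∑_{j=0}^{k} C(2j, j)/2^{3j} ]. -/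
open MeasureTheory

namespace GaussianMoment

open Set Filter

/-- The Gaussian-weighted monomial `x ^ n * exp (-b * x ^ 2)`. -/
noncomputable def weight (b : ℝ) (n : ℕ) (x : ℝ) : ℝ := x ^ n * Real.exp (-b * x ^ 2)

/-- The upper tail `∫ x in (a, ∞), x ^ n * exp (-b * x ^ 2)`. -/
noncomputable def tail (b : ℝ) (n : ℕ) (a : ℝ) : ℝ := ∫ x in Ioi a, weight b n x

lemma integrable_weight {b : ℝ} (hb : 0 < b) (n : ℕ) : Integrable (weight b n) := by
  have h := integrable_rpow_mul_exp_neg_mul_sq hb (s := n)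
    (lt_of_lt_of_le (by norm_num) n.cast_nonneg)
  simp only [Real.rpow_natCast] at h
  exact h

lemma tail_one {b : ℝ} (hb : 0 < b) (a : ℝ) :
    2 * b * tail b 1 a = Real.exp (-b * a ^ 2) := by
  have hd : ∀ x ∈ Ici a, HasDerivAt (fun x => -weight b 0 x) (2 * b * weight b 1 x) x := by
    intro x _
    have h := (((hasDerivAt_pow 2 x).const_mul (-b)).exp).neg
    simp only [weight, pow_zero, one_mul]
    refine h.congr_deriv ?_
    simp
    ring
  have h0 := ((integrable_weight hb 0).neg).integrableOn (s := Ioi a)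
  have h1 := ((integrable_weight hb 1).const_mul (2 * b)).integrableOn (s := Ioi a)
  have ht := tendsto_zero_of_hasDerivAt_of_integrableOn_Ioi
    (fun x hx => hd x (Ioi_subset_Ici_self hx)) h1 h0
  have h := integral_Ioi_of_hasDerivAt_of_tendsto' hd h1 ht
  rw [integral_const_mul] at h
  rw [tail, h]
  simp [weight]

lemma tail_add_two {b : ℝ} (hb : 0 < b) (n : ℕ) (a : ℝ) :
    2 * b * tail b (n + 2) a = weight b (n + 1) a + (n + 1) * tail b n a := by
  have hd : ∀ x ∈ Ici a, HasDerivAt (fun x => -weight b (n + 1) x)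
      (2 * b * weight b (n + 2) x - (n + 1) * weight b n x) x := by
    intro x _
    have h := ((hasDerivAt_pow (n + 1) x).mul ((hasDerivAt_pow 2 x).const_mul (-b)).exp).neg
    simp only [weight]
    refine h.congr_deriv ?_
    simp
    ring
  have h0 := ((integrable_weight hb (n + 1)).neg).integrableOn (s := Ioi a)
  have h1 := ((integrable_weight hb (n + 2)).const_mul (2 * b)).integrableOn (s := Ioi a)
  have h2 := ((integrable_weight hb n).const_mul ((n : ℝ) + 1)).integrableOn (s := Ioi a)
  have ht := tendsto_zero_of_hasDerivAt_of_integrableOn_Ioi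
    (fun x hx => hd x (Ioi_subset_Ici_self hx)) (h1.sub h2) h0
  have h := integral_Ioi_of_hasDerivAt_of_tendsto' hd (h1.sub h2) ht
  rw [integral_sub h1 h2, integral_const_mul, integral_const_mul] at h
  rw [tail, tail]
  linarith

lemma setIntegral_Icc_weight {b : ℝ} (hb : 0 < b) (n : ℕ) {y : ℝ} (hy : 0 ≤ y) :
    ∫ x in Icc 0 y, weight b n x = tail b n 0 - tail b n y := by
  have h := (integrable_weight hb n)
  rw [integral_Icc_eq_integral_Ioc, tail, tail, ← Ioc_union_Ioi_eq_Ioi hy,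
    setIntegral_union Ioc_disjoint_Ioi_same measurableSet_Ioi h.integrableOn h.integrableOn]
  ring

lemma tail_one_even (k : ℕ) :
    tail 1 (2 * k) 0
      = Real.sqrt Real.pi * ((2 * k).factorial / (2 ^ (2 * k + 1) * k.factorial)) := by
  induction k with
  | zero =>
    have h := integral_gaussian_Ioi 1
    simp only [div_one] at h
    simp [tail, weight] at h ⊢
    rw [h]; ring
  | succ k ih =>
    have h := tail_add_two one_pos (2 * k) 0
    rw [ih] at h
    have h' : tail 1 (2 * (k + 1)) 0 = (2 * k + 1) / 2 * (Real.sqrt Real.pi *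
        ((2 * k).factorial / (2 ^ (2 * k + 1) * k.factorial))) := by
      rw [show 2 * (k + 1) = 2 * k + 2 by ring]
      simp [weight] at h
      linarith
    rw [h', show 2 * (k + 1) = 2 * k + 1 + 1 by ring, Nat.factorial_succ, Nat.factorial_succ,
      Nat.factorial_succ]
    push_cast
    field_simp
    ring

/-- The sector `0 ≤ x ≤ y` of the plane. -/
def sector : Set (ℝ × ℝ) := {q | 0 ≤ q.1 ∧ q.1 ≤ q.2}

lemma measurableSet_sector : MeasurableSet sector :=
  (measurableSet_le measurable_const measurable_fst).inter
    (measurableSet_le measurable_fst measurable_snd)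

/-- The moment of `x ^ m * y ^ n` over the sector, for the standard Gaussian weight. -/
noncomputable def sectorMoment (m n : ℕ) : ℝ :=
  ∫ q in sector, weight (1 / 2) m q.1 * weight (1 / 2) n q.2

lemma integrable_weight_mul_weight (m n : ℕ) :
    Integrable (fun q : ℝ × ℝ => weight (1 / 2) m q.1 * weight (1 / 2) n q.2) :=
  (integrable_weight one_half_pos m).mul_prod (integrable_weight one_half_pos n)

lemma integral_indicator_sector (m n : ℕ) (x : ℝ) :
    ∫ y, sector.indicator (fun q => weight (1 / 2) m q.1 * weight (1 / 2) n q.2) (x, y)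
      = (Ici 0).indicator (fun x => weight (1 / 2) m x * tail (1 / 2) n x) x := by
  by_cases hx : 0 ≤ x
  · rw [indicator_of_mem (mem_Ici.2 hx), tail, ← integral_Ici_eq_integral_Ioi,
      ← integral_const_mul, ← integral_indicator measurableSet_Ici]
    congr 1 with y
    simp [indicator, sector, hx]
  · simp [indicator, sector, hx]

lemma sectorMoment_eq_integral_mul_tail (m n : ℕ) :
    sectorMoment m n = ∫ x in Ioi 0, weight (1 / 2) m x * tail (1 / 2) n x := by
  have hi := (integrable_weight_mul_weight m n).indicator measurableSet_sector
  rw [sectorMoment, ← integral_indicator measurableSet_sector, Measure.volume_eq_prod,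
    integral_prod _ hi, ← integral_Ici_eq_integral_Ioi, ← integral_indicator measurableSet_Ici]
  simp_rw [integral_indicator_sector]

lemma integrableOn_weight_mul_tail (m n : ℕ) :
    IntegrableOn (fun x => weight (1 / 2) m x * tail (1 / 2) n x) (Ioi 0) := by
  have h := ((integrable_weight_mul_weight m n).indicator
    measurableSet_sector).integral_prod_left
  simp_rw [integral_indicator_sector] at h
  exact ((integrable_indicator_iff measurableSet_Ici).1 h).mono_set Ioi_subset_Ici_self

lemma sectorMoment_add_swap (m n : ℕ) :
    sectorMoment m n + sectorMoment n m = tail (1 / 2) m 0 * tail (1 / 2) n 0 := by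
  have hi := (integrable_weight_mul_weight m n).indicator measurableSet_sector
  have hn := (integrable_weight (b := 1 / 2) one_half_pos n).integrableOn (s := Ioi 0)
  have h : sectorMoment m n
      = ∫ y in Ioi 0, weight (1 / 2) n y * (tail (1 / 2) m 0 - tail (1 / 2) m y) := by
    rw [sectorMoment, ← integral_indicator measurableSet_sector, Measure.volume_eq_prod,
      integral_prod_symm _ hi, ← integral_Ici_eq_integral_Ioi,
      ← integral_indicator measurableSet_Ici]
    congr 1 with y
    by_cases hy : 0 ≤ y
    · rw [indicator_of_mem (mem_Ici.2 hy), ← setIntegral_Icc_weight one_half_pos m hy,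
        ← integral_const_mul, ← integral_indicator measurableSet_Icc]
      congr 1 with x
      simp [indicator, sector, mul_comm]
    · have hxy (x : ℝ) : ¬ (0 ≤ x ∧ x ≤ y) := fun h => hy (h.1.trans h.2)
      simp [indicator, sector, hy, hxy]
  rw [h, sectorMoment_eq_integral_mul_tail n m]
  simp_rw [mul_sub]
  rw [integral_sub (hn.mul_const _) (integrableOn_weight_mul_tail n m), integral_mul_const,
    sub_add_cancel, mul_comm]
  rfl

lemma weight_half_mul_weight_half (m n : ℕ) (x : ℝ) :
    weight (1 / 2) m x * weight (1 / 2) n x = weight 1 (m + n) x := by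
  have h : -1 * x ^ 2 = -(1 / 2) * x ^ 2 + -(1 / 2) * x ^ 2 := by ring
  rw [weight, weight, weight, h, Real.exp_add]
  ring

lemma sectorMoment_add_two_right (m n : ℕ) :
    sectorMoment m (n + 2) = tail 1 (m + n + 1) 0 + (n + 1) * sectorMoment m n := by
  have h (x : ℝ) : weight (1 / 2) m x * tail (1 / 2) (n + 2) x
      = weight 1 (m + n + 1) x + (n + 1) * (weight (1 / 2) m x * tail (1 / 2) n x) := by
    have ht := tail_add_two one_half_pos n x
    rw [show tail (1 / 2) (n + 2) x = weight (1 / 2) (n + 1) x + (n + 1) * tail (1 / 2) n x by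
      linarith, mul_add, weight_half_mul_weight_half]
    ring_nf
  simp_rw [sectorMoment_eq_integral_mul_tail, h]
  rw [integral_add (integrable_weight one_pos _).integrableOn
    ((integrableOn_weight_mul_tail m n).const_mul _), integral_const_mul]
  rfl

lemma sectorMoment_add_two_left (m n : ℕ) :
    sectorMoment (m + 2) n = (m + 1) * sectorMoment m n - tail 1 (m + n + 1) 0 := by
  have h1 := sectorMoment_add_swap (m + 2) n
  have h2 := sectorMoment_add_swap m n
  have h3 := sectorMoment_add_two_right n m
  have h4 : tail (1 / 2) (m + 2) 0 = (m + 1) * tail (1 / 2) m 0 := by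
    have h := tail_add_two one_half_pos m 0
    simp [weight] at h
    simpa using h
  rw [h4] at h1
  rw [add_comm n m] at h3
  linear_combination h1 - h3 - (m + 1 : ℝ) * h2

lemma sectorMoment_zero_one : sectorMoment 0 1 = Real.sqrt Real.pi / 2 := by
  have h (x : ℝ) : weight (1 / 2) 0 x * tail (1 / 2) 1 x = weight 1 0 x := by
    have ht := tail_one one_half_pos x
    rw [show tail (1 / 2) 1 x = weight (1 / 2) 0 x by simp [weight] at ht ⊢; linarith,
      weight_half_mul_weight_half]
  have h0 := tail_one_even 0
  simp_rw [sectorMoment_eq_integral_mul_tail, h]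
  change tail 1 0 0 = _
  simpa [div_eq_mul_inv] using h0

lemma sectorMoment_one_zero :
    sectorMoment 1 0 = Real.sqrt Real.pi / 2 * (Real.sqrt 2 - 1) := by
  have h := sectorMoment_add_swap 1 0
  have h1 : tail (1 / 2) 1 0 = 1 := by
    have ht := tail_one one_half_pos 0
    simp at ht ⊢
    linarith
  have h2 : tail (1 / 2) 0 0 = Real.sqrt Real.pi * Real.sqrt 2 / 2 := by
    have ht := integral_gaussian_Ioi (1 / 2)
    rw [div_div_eq_mul_div, div_one, Real.sqrt_mul Real.pi_pos.le] at ht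
    simpa [tail, weight] using ht
  rw [h1, h2, sectorMoment_zero_one] at h
  linarith

/-- The partial sum of the series `∑ C(2j, j) / 8 ^ j = √2`. -/
noncomputable def centralBinomSum (k : ℕ) : ℝ :=
  ∑ j ∈ Finset.range (k + 1), (Nat.choose (2 * j) j : ℝ) / 2 ^ (3 * j)

lemma centralBinomSum_succ (k : ℕ) :
    centralBinomSum (k + 1) = centralBinomSum k
      + (2 * (k + 1)).factorial / (2 ^ (3 * (k + 1)) * (k + 1).factorial ^ 2) := by
  rw [centralBinomSum, Finset.sum_range_succ, ← centralBinomSum,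
    Nat.cast_choose ℝ (show k + 1 ≤ 2 * (k + 1) by lia),
    show 2 * (k + 1) - (k + 1) = k + 1 by lia]
  field_simp

lemma two_pow_mul_factorial_mul_centralBinomSum_succ (k : ℕ) :
    Real.sqrt Real.pi * (2 ^ (k + 1) * (k + 1).factorial / 2 * centralBinomSum (k + 1))
      = 2 * (k + 1) * (Real.sqrt Real.pi * (2 ^ k * k.factorial / 2 * centralBinomSum k))
        + tail 1 (2 * (k + 1)) 0 := by
  rw [centralBinomSum_succ, tail_one_even, Nat.factorial_succ k]
  push_cast
  field_simp
  ring

lemma sectorMoment_zero_odd (k : ℕ) :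
    sectorMoment 0 (2 * k + 1)
      = Real.sqrt Real.pi * (2 ^ k * k.factorial / 2 * centralBinomSum k) := by
  induction k with
  | zero => simp [sectorMoment_zero_one, centralBinomSum, div_eq_mul_inv]
  | succ k ih =>
    have h := sectorMoment_add_two_right 0 (2 * k + 1)
    rw [ih, show 0 + (2 * k + 1) + 1 = 2 * (k + 1) by ring] at h
    rw [two_pow_mul_factorial_mul_centralBinomSum_succ,
      show 2 * (k + 1) + 1 = 2 * k + 1 + 2 by ring, h]
    push_cast
    ring

lemma sectorMoment_odd_zero (k : ℕ) :
    sectorMoment (2 * k + 1) 0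
      = Real.sqrt Real.pi
        * (2 ^ k * k.factorial / 2 * (Real.sqrt 2 - centralBinomSum k)) := by
  induction k with
  | zero => simp [sectorMoment_one_zero, centralBinomSum]; ring
  | succ k ih =>
    have h := sectorMoment_add_two_left (2 * k + 1) 0
    have hs := two_pow_mul_factorial_mul_centralBinomSum_succ k
    rw [ih, show 2 * k + 1 + 0 + 1 = 2 * (k + 1) by ring] at h
    rw [show 2 * (k + 1) + 1 = 2 * k + 1 + 2 by ring, h]
    rw [Nat.factorial_succ] at hs ⊢
    push_cast at hs ⊢
    linear_combination hs

lemma tail_one_even_add_two (k : ℕ) :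
    tail 1 (2 * k + 2) 0 = (2 * k + 1) / 2 * tail 1 (2 * k) 0 := by
  have h := tail_add_two one_pos (2 * k) 0
  simp [weight] at h
  linarith

lemma setIntegral_sector_eq (a b : ℕ) :
    ∫ q in sector, q.1 ^ a * q.2 ^ b * (q.2 ^ 2 - q.1 ^ 2) ^ 2
        * Real.exp (-(q.1 ^ 2 + q.2 ^ 2) / 2)
      = sectorMoment a (b + 4) - 2 * sectorMoment (a + 2) (b + 2) + sectorMoment (a + 4) b := by
  have hi (m n : ℕ) := (integrable_weight_mul_weight m n).integrableOn (s := sector)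
  have h (q : ℝ × ℝ) : q.1 ^ a * q.2 ^ b * (q.2 ^ 2 - q.1 ^ 2) ^ 2
        * Real.exp (-(q.1 ^ 2 + q.2 ^ 2) / 2)
      = weight (1 / 2) a q.1 * weight (1 / 2) (b + 4) q.2
        - 2 * (weight (1 / 2) (a + 2) q.1 * weight (1 / 2) (b + 2) q.2)
        + weight (1 / 2) (a + 4) q.1 * weight (1 / 2) b q.2 := by
    rw [show -(q.1 ^ 2 + q.2 ^ 2) / 2 = -(1 / 2) * q.1 ^ 2 + -(1 / 2) * q.2 ^ 2 by ring,
      Real.exp_add]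
    simp only [weight]
    ring
  simp_rw [h]
  rw [integral_add (by exact (hi _ _).sub ((hi _ _).const_mul 2)) (hi _ _),
    integral_sub (hi _ _) ((hi _ _).const_mul 2), integral_const_mul]
  rfl

lemma setIntegral_sector_odd_two (k : ℕ) :
    ∫ q in sector, q.1 ^ (2 * k + 1) * q.2 ^ 2 * (q.2 ^ 2 - q.1 ^ 2) ^ 2
        * Real.exp (-(q.1 ^ 2 + q.2 ^ 2) / 2)
      = (14 - 4 * k) * tail 1 (2 * (k + 1)) 0
        + (4 * k ^ 2 + 11) * sectorMoment (2 * k + 1) 0 := by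
  have g1 := tail_one_even_add_two (k + 1)
  have r1 := sectorMoment_add_two_right (2 * k + 1) 4
  have r2 := sectorMoment_add_two_right (2 * k + 1) 2
  have r3 := sectorMoment_add_two_right (2 * k + 1) 0
  have r4 := sectorMoment_add_two_right (2 * k + 3) 2
  have r5 := sectorMoment_add_two_right (2 * k + 3) 0
  have r6 := sectorMoment_add_two_right (2 * k + 5) 0
  have l1 := sectorMoment_add_two_left (2 * k + 1) 0
  have l2 := sectorMoment_add_two_left (2 * k + 3) 0
  rw [setIntegral_sector_eq]
  ring_nf at *
  push_cast at *
  rw [r1, r2, r3, r4, r5, r6, l2, l1, g1]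
  ring

lemma setIntegral_sector_two_odd (k : ℕ) :
    ∫ q in sector, q.1 ^ 2 * q.2 ^ (2 * k + 1) * (q.2 ^ 2 - q.1 ^ 2) ^ 2
        * Real.exp (-(q.1 ^ 2 + q.2 ^ 2) / 2)
      = -((14 - 4 * k) * tail 1 (2 * (k + 1)) 0)
        + (4 * k ^ 2 + 11) * sectorMoment 0 (2 * k + 1) := by
  have g1 := tail_one_even_add_two (k + 1)
  have r1 := sectorMoment_add_two_left 4 (2 * k + 1)
  have r2 := sectorMoment_add_two_left 2 (2 * k + 1)
  have r3 := sectorMoment_add_two_left 0 (2 * k + 1)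
  have r4 := sectorMoment_add_two_left 2 (2 * k + 3)
  have r5 := sectorMoment_add_two_left 0 (2 * k + 3)
  have r6 := sectorMoment_add_two_left 0 (2 * k + 5)
  have l1 := sectorMoment_add_two_right 0 (2 * k + 1)
  have l2 := sectorMoment_add_two_right 0 (2 * k + 3)
  rw [setIntegral_sector_eq]
  ring_nf at *
  push_cast at *
  rw [r1, r2, r3, r4, r5, r6, l2, l1, g1]
  ring

end GaussianMoment

/-- odd-moment integrals of the two branches of the continuous
2-watermelon with wall condition. `C(2j,j)` is the central binomial coefficient. -/
theorem melonW2_odd_moment_integrals (k : ℕ) (hk : 1 ≤ k) :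
    ((∫ q in {q : ℝ × ℝ | 0 ≤ q.1 ∧ q.1 ≤ q.2},
        q.1 ^ (2 * k - 1) * (q.2 ^ 2 - q.1 ^ 2) ^ 2 * q.1 ^ 2 * q.2 ^ 2 *
          Real.exp (-(q.1 ^ 2 + q.2 ^ 2) / 2))
      = Real.sqrt Real.pi *
          ((Nat.factorial (2 * k + 2) : ℝ) * (14 - 4 * (k : ℝ))
              / (2 ^ (2 * k + 3) * (Nat.factorial (k + 1) : ℝ))
            + (4 * (k : ℝ) ^ 2 + 11) * 2 ^ (k - 1) * (Nat.factorial k : ℝ) *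
              (Real.sqrt 2 - ∑ j ∈ Finset.range (k + 1),
                (Nat.choose (2 * j) j : ℝ) / 2 ^ (3 * j))))
    ∧ ((∫ q in {q : ℝ × ℝ | 0 ≤ q.1 ∧ q.1 ≤ q.2},
        q.2 ^ (2 * k - 1) * (q.2 ^ 2 - q.1 ^ 2) ^ 2 * q.1 ^ 2 * q.2 ^ 2 *
          Real.exp (-(q.1 ^ 2 + q.2 ^ 2) / 2))
      = Real.sqrt Real.pi *
          (-((Nat.factorial (2 * k + 2) : ℝ) * (14 - 4 * (k : ℝ))
              / (2 ^ (2 * k + 3) * (Nat.factorial (k + 1) : ℝ)))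
            + (4 * (k : ℝ) ^ 2 + 11) * 2 ^ (k - 1) * (Nat.factorial k : ℝ) *
              ∑ j ∈ Finset.range (k + 1),
                (Nat.choose (2 * j) j : ℝ) / 2 ^ (3 * j))) := by
  obtain ⟨n, rfl⟩ : ∃ n, k = n + 1 := ⟨k - 1, by lia⟩
  have h1 := GaussianMoment.setIntegral_sector_odd_two (n + 1)
  have h2 := GaussianMoment.setIntegral_sector_two_odd (n + 1)
  rw [GaussianMoment.sectorMoment_odd_zero, GaussianMoment.tail_one_even] at h1
  rw [GaussianMoment.sectorMoment_zero_odd, GaussianMoment.tail_one_even] at h2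
  have e : 2 * (n + 1) - 1 = 2 * n + 1 := by lia
  rw [e, Nat.add_sub_cancel]
  constructor
  · refine Eq.trans (integral_congr_ae (ae_of_all _ fun q => ?_)) (h1.trans ?_)
    · ring
    · rw [GaussianMoment.centralBinomSum]
      ring_nf
  · refine Eq.trans (integral_congr_ae (ae_of_all _ fun q => ?_)) (h2.trans ?_)
    · ring
    · rw [GaussianMoment.centralBinomSum]
      ring_nf
end
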